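/- Let 𝓜 ⊆ 𝒲 be a set of periodic waves such that the image τ(𝓜) is a connected subset of C([0, L], ℝ⁷). Suppose 𝓜 contains at least one trivial wave and that every nontrivial wave in 𝓜 satisfies u_xx(L, η(L)) ≠ 0 (that is, u_xx ≠ 0 at the trough). Then for every wave in 𝓜 and every point of the closure of Ω one has |v| < |u|; in other words, the slope |v/u| of every streamline of every wave in 𝓜 is strictly less than 1. -/

import Mathlib

open Set

/-- Partial derivative in the horizontal direction. -/
noncomputable def pdX (f : ℝ × ℝ → ℝ) (p : ℝ × ℝ) : ℝ := fderiv ℝ f p (1, 0)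

/-- Partial derivative in the vertical direction. -/
noncomputable def pdY (f : ℝ × ℝ → ℝ) (p : ℝ × ℝ) : ℝ := fderiv ℝ f p (0, 1)

/-- A symmetric `2L`-periodic steady gravity water wave with vorticity, in the frame
moving with the wave.  The fluid occupies `Ω = {(x,y) : -L < x < L, -d < y < η x}`;
`u, v` are the relative velocity components, `P` is the pressure, `η` the surface
profile, `ψ` the stream function and `γ` the vorticity function. -/
structure PeriodicWave (g Patm L : ℝ) : Type where
  u : ℝ × ℝ → ℝ
  v : ℝ × ℝ → ℝ
  P : ℝ × ℝ → ℝ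
  η : ℝ → ℝ
  ψ : ℝ × ℝ → ℝ
  γ : ℝ → ℝ
  d : ℝ
  m : ℝ
  d_pos : 0 < d
  m_pos : 0 < m
  u_smooth : ContDiff ℝ 3 u
  v_smooth : ContDiff ℝ 3 v
  P_smooth : ContDiff ℝ 3 P
  η_smooth : ContDiff ℝ 4 η
  ψ_smooth : ContDiff ℝ 4 ψ
  γ_smooth : ContDiffOn ℝ 2 γ (Icc 0 m)
  u_periodic : ∀ x y, u (x + 2 * L, y) = u (x, y)
  v_periodic : ∀ x y, v (x + 2 * L, y) = v (x, y)
  P_periodic : ∀ x y, P (x + 2 * L, y) = P (x, y)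
  η_periodic : ∀ x, η (x + 2 * L) = η x
  η_mean : (∫ x in (-L)..L, η x) = 0
  u_even : ∀ x y, u (-x, y) = u (x, y)
  v_odd : ∀ x y, v (-x, y) = -v (x, y)
  P_even : ∀ x y, P (-x, y) = P (x, y)
  η_even : ∀ x, η (-x) = η x
  euler_x : ∀ x y, -d < y → y < η x →
    u (x, y) * pdX u (x, y) + v (x, y) * pdY u (x, y) = -pdX P (x, y)
  euler_y : ∀ x y, -d < y → y < η x →
    u (x, y) * pdX v (x, y) + v (x, y) * pdY v (x, y) = -(pdY P (x, y)) - g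
  incompressible : ∀ x y, -d < y → y < η x → pdX u (x, y) + pdY v (x, y) = 0
  surface_pressure : ∀ x, P (x, η x) = Patm
  surface_kinematic : ∀ x, v (x, η x) = deriv η x * u (x, η x)
  bed_kinematic : ∀ x, v (x, -d) = 0
  nonstagnant : ∃ δ > 0, ∀ x y, -d ≤ y → y ≤ η x → u (x, y) ≤ -δ
  psi_x : ∀ x y, -d ≤ y → y ≤ η x → pdX ψ (x, y) = -v (x, y)
  psi_y : ∀ x y, -d ≤ y → y ≤ η x → pdY ψ (x, y) = u (x, y)
  psi_surface : ∀ x, ψ (x, η x) = 0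
  psi_bed : ∀ x, ψ (x, -d) = m
  vorticity_eq : ∀ x y, -d < y → y < η x → pdX v (x, y) - pdY u (x, y) = γ (ψ (x, y))

namespace PeriodicWave

variable {g Patm L : ℝ}

/-- The closure of one period `Ω` of the fluid domain. -/
def Ωbar (W : PeriodicWave g Patm L) : Set (ℝ × ℝ) :=
  {p | -L ≤ p.1 ∧ p.1 ≤ L ∧ -W.d ≤ p.2 ∧ p.2 ≤ W.η p.1}

/-- The open half period `Ω⁺` of the fluid domain. -/
def Ωplus (W : PeriodicWave g Patm L) : Set (ℝ × ℝ) :=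
  {p | 0 < p.1 ∧ p.1 < L ∧ -W.d < p.2 ∧ p.2 < W.η p.1}

/-- The half period `S⁺` of the free surface. -/
def Splus (W : PeriodicWave g Patm L) : Set (ℝ × ℝ) :=
  {p | 0 < p.1 ∧ p.1 < L ∧ p.2 = W.η p.1}

/-- A wave is trivial if `u, v, P, η` depend only on `y`. -/
def IsTrivial (W : PeriodicWave g Patm L) : Prop :=
  (∀ p, W.v p = 0) ∧ (∀ x, W.η x = 0) ∧
    (∀ x x' y, W.u (x, y) = W.u (x', y)) ∧ (∀ x x' y, W.P (x, y) = W.P (x', y))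

/-- The streamline monotonicity condition `v > 0` on `Ω⁺ ∪ S⁺`. -/
def MonotoneHalf (W : PeriodicWave g Patm L) : Prop :=
  ∀ p ∈ W.Ωplus ∪ W.Splus, 0 < W.v p

/-- Membership in the water-wave set 𝒲 : the vorticity function satisfies
`γ ≤ 0`, `γ' ≤ 0`, `γ'' ≤ 0` on `[0, m]`, and the wave is either trivial or
monotone. -/
def MemW (W : PeriodicWave g Patm L) : Prop :=
  (∀ s ∈ Icc (0:ℝ) W.m, W.γ s ≤ 0) ∧
  (∀ s ∈ Icc (0:ℝ) W.m, derivWithin W.γ (Icc 0 W.m) s ≤ 0) ∧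
  (∀ s ∈ Icc (0:ℝ) W.m, derivWithin (derivWithin W.γ (Icc 0 W.m)) (Icc 0 W.m) s ≤ 0) ∧
  (W.IsTrivial ∨ W.MonotoneHalf)

/-- The trace of `(u, v, u_x, v_x, u_y, u_xx, u_xy)` on the free surface. -/
noncomputable def trace (W : PeriodicWave g Patm L) (x : ℝ) :
    ℝ × ℝ × ℝ × ℝ × ℝ × ℝ × ℝ :=
  (W.u (x, W.η x), W.v (x, W.η x), pdX W.u (x, W.η x), pdX W.v (x, W.η x),
    pdY W.u (x, W.η x), pdX (pdX W.u) (x, W.η x), pdY (pdX W.u) (x, W.η x))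

end PeriodicWave

open Topology Filter

theorem contDiff_pdX {f : ℝ × ℝ → ℝ} {m n : WithTop ℕ∞} (hf : ContDiff ℝ n f)
    (h : m + 1 ≤ n) : ContDiff ℝ m (pdX f) :=
  (hf.fderiv_right h).clm_apply contDiff_const

theorem contDiff_pdY {f : ℝ × ℝ → ℝ} {m n : WithTop ℕ∞} (hf : ContDiff ℝ n f)
    (h : m + 1 ≤ n) : ContDiff ℝ m (pdY f) :=
  (hf.fderiv_right h).clm_apply contDiff_const

theorem hasDerivAt_graph {f : ℝ × ℝ → ℝ} (hf : Differentiable ℝ f) {h : ℝ → ℝ} {c x : ℝ}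
    (hh : HasDerivAt h c x) :
    HasDerivAt (fun t => f (t, h t)) (pdX f (x, h x) + c * pdY f (x, h x)) x := by
  have h1 := (hf (x, h x)).hasFDerivAt.comp_hasDerivAt x ((hasDerivAt_id x).prodMk hh)
  have h2 : ((1 : ℝ), c) = (1, 0) + c • (0, 1) := by simp
  rw [h2, map_add, map_smul] at h1
  exact h1

theorem hasDerivAt_sliceX {f : ℝ × ℝ → ℝ} (hf : Differentiable ℝ f) (x y : ℝ) :
    HasDerivAt (fun t => f (t, y)) (pdX f (x, y)) x := by
  simpa using hasDerivAt_graph hf (hasDerivAt_const x y)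

theorem hasDerivAt_sliceY {f : ℝ × ℝ → ℝ} (hf : Differentiable ℝ f) (x y : ℝ) :
    HasDerivAt (fun t => f (x, t)) (pdY f (x, y)) y :=
  (hf (x, y)).hasFDerivAt.comp_hasDerivAt y ((hasDerivAt_const y x).prodMk (hasDerivAt_id y))

theorem pdX_pdY_comm {f : ℝ × ℝ → ℝ} (hf : ContDiff ℝ 2 f) :
    pdX (pdY f) = pdY (pdX f) := by
  funext p
  have hd : DifferentiableAt ℝ (fderiv ℝ f) p :=
    ((hf.fderiv_right (m := 1) (by norm_num)).differentiable one_ne_zero) p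
  have hX : pdX (pdY f) p = fderiv ℝ (fderiv ℝ f) p (1, 0) (0, 1) := by
    change fderiv ℝ (fun q => fderiv ℝ f q (0, 1)) p (1, 0) = _
    rw [fderiv_clm_apply hd (differentiableAt_const _)]
    simp
  have hY : pdY (pdX f) p = fderiv ℝ (fderiv ℝ f) p (0, 1) (1, 0) := by
    change fderiv ℝ (fun q => fderiv ℝ f q (1, 0)) p (0, 1) = _
    rw [fderiv_clm_apply hd (differentiableAt_const _)]
    simp
  rw [hX, hY]
  exact (hf.contDiffAt.isSymmSndFDerivAt (by simp)).eq _ _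

/-- A function that is bounded below by its value at `x` just to the right of `x` has
nonnegative derivative at `x`. -/
theorem HasDerivAt.nonneg_of_eventually_right {f : ℝ → ℝ} {c x : ℝ} (hf : HasDerivAt f c x)
    (h : ∀ᶠ t in 𝓝[>] x, f x ≤ f t) : 0 ≤ c := by
  have h1 := (hasDerivAt_iff_tendsto_slope.1 hf).mono_left
    (nhdsGT_le_nhdsNE x)
  refine ge_of_tendsto h1 ?_
  filter_upwards [h, self_mem_nhdsWithin] with t ht (hxt : x < t)
  rw [slope_def_field]
  exact div_nonneg (sub_nonneg.2 ht) (sub_nonneg.2 hxt.le)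

/-- A function that is bounded above by its value at `x` just to the left of `x` has
nonnegative derivative at `x`. -/
theorem HasDerivAt.nonneg_of_eventually_left {f : ℝ → ℝ} {c x : ℝ} (hf : HasDerivAt f c x)
    (h : ∀ᶠ t in 𝓝[<] x, f t ≤ f x) : 0 ≤ c := by
  have h1 := (hasDerivAt_iff_tendsto_slope.1 hf).mono_left
    (nhdsLT_le_nhdsNE x)
  refine ge_of_tendsto h1 ?_
  filter_upwards [h, self_mem_nhdsWithin] with t ht (hxt : t < x)
  rw [slope_def_field]
  exact div_nonneg_of_nonpos (sub_nonpos.2 ht) (sub_nonpos.2 hxt.le)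

/-- Second-order one-sided condition at a critical point. -/
theorem nonneg_second_deriv_of_eventually_right {f f' : ℝ → ℝ} {c x : ℝ}
    (hf : ∀ t, HasDerivAt f (f' t) t) (hf' : HasDerivAt f' c x) (h0 : f' x = 0)
    (h : ∀ᶠ t in 𝓝[>] x, f x ≤ f t) : 0 ≤ c := by
  by_contra! hc
  have h1 := (hasDerivAt_iff_tendsto_slope.1 hf').mono_left
    (nhdsGT_le_nhdsNE x)
  have h2 : ∀ᶠ t in 𝓝[>] x, f' t < 0 := by
    filter_upwards [h1.eventually_lt_const hc, self_mem_nhdsWithin] with t ht (hxt : x < t)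
    rw [slope_def_field, h0, sub_zero] at ht
    by_contra! hn
    exact absurd (div_nonneg hn (sub_nonneg.2 hxt.le)) (not_le.2 ht)
  obtain ⟨b, hb, hbx⟩ := mem_nhdsGT_iff_exists_Ioo_subset.1 (h2.and h)
  have hb : x < b := hb
  have hm : x < (x + b) / 2 ∧ (x + b) / 2 < b := by constructor <;> linarith
  have hanti : StrictAntiOn f (Icc x ((x + b) / 2)) := by
    refine strictAntiOn_of_deriv_neg (convex_Icc _ _)
      (fun t _ => (hf t).continuousAt.continuousWithinAt) fun t ht => ?_
    rw [interior_Icc] at ht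
    rw [(hf t).deriv]
    exact (hbx ⟨ht.1, ht.2.trans hm.2⟩).1
  have := hanti (left_mem_Icc.2 hm.1.le) (right_mem_Icc.2 hm.1.le) hm.1
  exact absurd (hbx ⟨hm.1, hm.2⟩).2 (not_le.2 this)

theorem IsLocalMax.second_deriv_nonpos {f f' : ℝ → ℝ} {c x : ℝ} (h : IsLocalMax f x)
    (hf : ∀ t, HasDerivAt f (f' t) t) (hf' : HasDerivAt f' c x) : c ≤ 0 := by
  have := nonneg_second_deriv_of_eventually_right (f := fun t => -f t) (f' := fun t => -f' t)
    (fun t => (hf t).neg) hf'.neg (by simp [h.hasDerivAt_eq_zero (hf x)])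
    (by
      have h1 : ∀ᶠ t in 𝓝 x, f t ≤ f x := h
      filter_upwards [nhdsWithin_le_nhds h1] with t ht
      exact neg_le_neg ht)
  linarith

theorem isCompact_subgraph {η : ℝ → ℝ} (hη : Continuous η) (a b c : ℝ) :
    IsCompact {p : ℝ × ℝ | a ≤ p.1 ∧ p.1 ≤ b ∧ c ≤ p.2 ∧ p.2 ≤ η p.1} := by
  obtain ⟨K, hK⟩ := (isCompact_Icc (a := a) (b := b)).bddAbove_image hη.continuousOn
  refine ((isCompact_Icc (a := a) (b := b)).prod (isCompact_Icc (a := c) (b := K))).of_isClosed_subset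
    ?_ ?_
  · exact (isClosed_le continuous_const continuous_fst).inter
      ((isClosed_le continuous_fst continuous_const).inter
        ((isClosed_le continuous_const continuous_snd).inter
          (isClosed_le continuous_snd (hη.comp continuous_fst))))
  · rintro ⟨x, y⟩ ⟨h1, h2, h3, h4⟩
    exact ⟨⟨h1, h2⟩, h3, h4.trans (hK ⟨x, ⟨h1, h2⟩, rfl⟩)⟩

theorem eventually_mem_subgraph {η : ℝ → ℝ} (hη : Continuous η) {a b c x y : ℝ}
    (hx : a < x) (hx' : x < b) (hy : c < y) (hy' : y < η x) :
    ∀ᶠ p : ℝ × ℝ in 𝓝 (x, y), a < p.1 ∧ p.1 < b ∧ c < p.2 ∧ p.2 < η p.1 := by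
  refine IsOpen.mem_nhds ?_ ⟨hx, hx', hy, hy'⟩
  exact (isOpen_lt continuous_const continuous_fst).inter
    ((isOpen_lt continuous_fst continuous_const).inter
      ((isOpen_lt continuous_const continuous_snd).inter
        (isOpen_lt continuous_snd (hη.comp continuous_fst))))

/-- At an interior maximum over a region below a graph the Laplacian is nonpositive. -/
theorem laplacian_nonpos_of_isMax {η : ℝ → ℝ} (hη : Continuous η) {a b c : ℝ}
    {z zx zxx zy zyy : ℝ → ℝ → ℝ}
    (hx : ∀ x y, HasDerivAt (fun t => z t y) (zx x y) x)
    (hxx : ∀ x y, HasDerivAt (fun t => zx t y) (zxx x y) x)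
    (hy : ∀ x y, HasDerivAt (fun t => z x t) (zy x y) y)
    (hyy : ∀ x y, HasDerivAt (fun t => zy x t) (zyy x y) y)
    {x y : ℝ} (hax : a < x) (hxb : x < b) (hcy : c < y) (hyη : y < η x)
    (hmax : ∀ x' y', a < x' → x' < b → c < y' → y' < η x' → z x' y' ≤ z x y) :
    zxx x y + zyy x y ≤ 0 := by
  have hev := eventually_mem_subgraph hη hax hxb hcy hyη
  have h1 : IsLocalMax (fun t => z t y) x := by
    have : Tendsto (fun t : ℝ => (t, y)) (𝓝 x) (𝓝 (x, y)) :=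
      (Continuous.prodMk_left y).tendsto x
    filter_upwards [this.eventually hev] with t ht
    exact hmax _ _ ht.1 ht.2.1 ht.2.2.1 ht.2.2.2
  have h2 : IsLocalMax (fun t => z x t) y := by
    have : Tendsto (fun t : ℝ => (x, t)) (𝓝 y) (𝓝 (x, y)) :=
      (Continuous.prodMk_right x).tendsto y
    filter_upwards [this.eventually hev] with t ht
    exact hmax _ _ ht.1 ht.2.1 ht.2.2.1 ht.2.2.2
  have := IsLocalMax.second_deriv_nonpos h1 (hx · y) (hxx x y)
  have := IsLocalMax.second_deriv_nonpos h2 (hy x) (hyy x y)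
  linarith

/-- Weak maximum principle on a region below a graph. -/
theorem weak_maximum_principle {η : ℝ → ℝ} (hη : Continuous η) {a b c : ℝ}
    {z zx zxx zy zyy : ℝ → ℝ → ℝ} (hz : Continuous fun p : ℝ × ℝ => z p.1 p.2)
    (hx : ∀ x y, HasDerivAt (fun t => z t y) (zx x y) x)
    (hxx : ∀ x y, HasDerivAt (fun t => zx t y) (zxx x y) x)
    (hy : ∀ x y, HasDerivAt (fun t => z x t) (zy x y) y)
    (hyy : ∀ x y, HasDerivAt (fun t => zy x t) (zyy x y) y)
    (hinner : ∀ x y, a < x → x < b → c < y → y < η x → 0 < z x y → 0 ≤ zxx x y + zyy x y)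
    (hleft : ∀ y, c ≤ y → y ≤ η a → z a y ≤ 0)
    (hright : ∀ y, c ≤ y → y ≤ η b → z b y ≤ 0)
    (hbot : ∀ x, a ≤ x → x ≤ b → z x c ≤ 0)
    (htop : ∀ x, a ≤ x → x ≤ b → c ≤ η x → z x (η x) ≤ 0)
    {x y : ℝ} (hax : a ≤ x) (hxb : x ≤ b) (hcy : c ≤ y) (hyη : y ≤ η x) : z x y ≤ 0 := by
  obtain ⟨K, hK⟩ := (isCompact_Icc (a := a) (b := b)).bddAbove_image
    (f := fun t : ℝ => t ^ 2) (by fun_prop)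
  have hK' : ∀ t, a ≤ t → t ≤ b → t ^ 2 ≤ K := fun t h h' => hK ⟨t, ⟨h, h'⟩, rfl⟩
  have key : ∀ ε > 0, z x y + ε * (x ^ 2 - K) ≤ 0 := by
    intro ε hε
    obtain ⟨⟨x0, y0⟩, ⟨h1, h2, h3, h4⟩, hmax⟩ :=
      (isCompact_subgraph hη a b c).exists_isMaxOn ⟨(x, y), hax, hxb, hcy, hyη⟩
        (f := fun p => z p.1 p.2 + ε * (p.1 ^ 2 - K)) (by fun_prop)
    simp only at h1 h2 h3 h4
    by_contra! hpos
    have hle : ∀ x' y', a ≤ x' → x' ≤ b → c ≤ y' → y' ≤ η x' →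
        z x' y' + ε * (x' ^ 2 - K) ≤ z x0 y0 + ε * (x0 ^ 2 - K) :=
      fun x' y' g1 g2 g3 g4 => hmax (show (x', y') ∈ _ from ⟨g1, g2, g3, g4⟩)
    have hz0 : 0 < z x0 y0 := by
      have := hle x y hax hxb hcy hyη
      nlinarith [hK' x0 h1 h2]
    have g1 : a < x0 := h1.lt_of_ne fun h => by
      subst h; exact absurd (hleft y0 h3 h4) (not_le.2 hz0)
    have g2 : x0 < b := h2.lt_of_ne fun h => by
      subst h; exact absurd (hright y0 h3 h4) (not_le.2 hz0)
    have g3 : c < y0 := h3.lt_of_ne fun h => by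
      subst h; exact absurd (hbot x0 h1 h2) (not_le.2 hz0)
    have g4 : y0 < η x0 := h4.lt_of_ne fun h => by
      subst h; exact absurd (htop x0 h1 h2 h3) (not_le.2 hz0)
    have hlap := laplacian_nonpos_of_isMax hη (a := a) (b := b) (c := c)
      (z := fun x y => z x y + ε * (x ^ 2 - K)) (zx := fun x y => zx x y + ε * (2 * x))
      (zxx := fun x y => zxx x y + ε * 2) (zy := zy) (zyy := zyy)
      (fun x y => by
        simpa using (hx x y).fun_add ((((hasDerivAt_id x).pow 2).sub_const K).const_mul ε))
      (fun x y => by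
        simpa using (hxx x y).fun_add (((hasDerivAt_id x).const_mul 2).const_mul ε))
      (fun x y => (hy x y).add_const _) hyy g1 g2 g3 g4
      (fun x' y' i1 i2 i3 i4 => hle x' y' i1.le i2.le i3.le i4.le)
    have := hinner x0 y0 g1 g2 g3 g4 hz0
    linarith
  by_contra! hpos
  have hKx := hK' x hax hxb
  have h1 := key (z x y / (2 * (K - x ^ 2 + 1))) (by
    have : 0 < K - x ^ 2 + 1 := by linarith
    positivity)
  have h2 : z x y / (2 * (K - x ^ 2 + 1)) * (x ^ 2 - K) ≥ - z x y / 2 := by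
    have : 0 < K - x ^ 2 + 1 := by linarith
    rw [ge_iff_le, div_mul_eq_mul_div, div_le_div_iff₀ (by norm_num) (by linarith)]
    nlinarith
  linarith

theorem nonpos_of_nonpos_Ioo {f : ℝ → ℝ} (hf : Continuous f) {a b : ℝ} (hab : a < b)
    (h : ∀ y, a < y → y < b → f y ≤ 0) {y : ℝ} (hay : a ≤ y) (hyb : y ≤ b) : f y ≤ 0 := by
  have hc : IsClosed {y | f y ≤ 0} := isClosed_le hf continuous_const
  have hs : Ioo a b ⊆ {y | f y ≤ 0} := fun y hy => h y hy.1 hy.2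
  have := closure_minimal hs hc
  rw [closure_Ioo hab.ne] at this
  exact this ⟨hay, hyb⟩

theorem eq_zero_of_eq_zero_Ioo {f : ℝ → ℝ} (hf : Continuous f) {a b : ℝ} (hab : a < b)
    (h : ∀ y, a < y → y < b → f y = 0) {y : ℝ} (hay : a ≤ y) (hyb : y ≤ b) : f y = 0 :=
  le_antisymm (nonpos_of_nonpos_Ioo hf hab (fun y h1 h2 => (h y h1 h2).le) hay hyb)
    (by simpa using nonpos_of_nonpos_Ioo hf.neg hab (fun y h1 h2 => by simp [h y h1 h2]) hay hyb)

namespace PeriodicWave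

variable {g Patm L : ℝ} (W : PeriodicWave g Patm L)

theorem differentiable_u : Differentiable ℝ W.u := W.u_smooth.differentiable (by norm_num)

theorem differentiable_v : Differentiable ℝ W.v := W.v_smooth.differentiable (by norm_num)

theorem differentiable_η : Differentiable ℝ W.η := W.η_smooth.differentiable (by norm_num)

theorem continuous_η : Continuous W.η := W.differentiable_η.continuous

theorem contDiff_ux : ContDiff ℝ 2 (pdX W.u) := contDiff_pdX W.u_smooth (by norm_num)

theorem contDiff_uy : ContDiff ℝ 2 (pdY W.u) := contDiff_pdY W.u_smooth (by norm_num)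

theorem contDiff_vx : ContDiff ℝ 2 (pdX W.v) := contDiff_pdX W.v_smooth (by norm_num)

theorem contDiff_vy : ContDiff ℝ 2 (pdY W.v) := contDiff_pdY W.v_smooth (by norm_num)

theorem bed_lt_surface (hL : 0 < L) (x : ℝ) : -W.d < W.η x := by
  have hne : ∀ x, W.η x ≠ -W.d := fun x h => by
    have h1 := W.psi_surface x
    rw [h, W.psi_bed x] at h1
    exact W.m_pos.ne' h1
  obtain ⟨x1, hx1⟩ : ∃ x1, -W.d < W.η x1 := by
    by_contra! hcon
    have h1 : (∫ x in (-L)..L, W.η x) ≤ ∫ _x in (-L)..L, -W.d :=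
      intervalIntegral.integral_mono_on (by linarith)
        (W.continuous_η.intervalIntegrable _ _) (by simp) fun x _ => hcon x
    rw [W.η_mean] at h1
    simp only [intervalIntegral.integral_const, smul_eq_mul] at h1
    nlinarith [W.d_pos]
  by_contra! hx
  obtain ⟨z, -, hz⟩ := intermediate_value_uIcc (a := x) (b := x1) W.continuous_η.continuousOn
    (Icc_subset_uIcc ⟨hx, hx1.le⟩)
  exact hne z hz

theorem u_neg {x y : ℝ} (h1 : -W.d ≤ y) (h2 : y ≤ W.η x) : W.u (x, y) < 0 := by
  obtain ⟨δ, hδ, h⟩ := W.nonstagnant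
  linarith [h x y h1 h2]

theorem psi_strictAntiOn (x : ℝ) :
    StrictAntiOn (fun y => W.ψ (x, y)) (Icc (-W.d) (W.η x)) := by
  have hd := hasDerivAt_sliceY (W.ψ_smooth.differentiable (by norm_num)) x
  refine strictAntiOn_of_deriv_neg (convex_Icc _ _)
    (fun t _ => (hd t).continuousAt.continuousWithinAt) fun t ht => ?_
  rw [interior_Icc] at ht
  rw [(hd t).deriv, W.psi_y x t ht.1.le ht.2.le]
  exact W.u_neg ht.1.le ht.2.le

theorem psi_mem_Ioo {x y : ℝ} (h1 : -W.d < y) (h2 : y < W.η x) :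
    W.ψ (x, y) ∈ Ioo 0 W.m := by
  have ha := W.psi_strictAntiOn x
  have h3 := ha ⟨h1.le, h2.le⟩ ⟨(h1.trans h2).le, le_rfl⟩ h2
  have h4 := ha ⟨le_rfl, (h1.trans h2).le⟩ ⟨h1.le, h2.le⟩ h1
  simp only [W.psi_surface, W.psi_bed] at h3 h4
  exact ⟨h3, h4⟩

/-- The derivative of the vorticity function. -/
noncomputable def dγ (s : ℝ) : ℝ := derivWithin W.γ (Icc 0 W.m) s

/-- The second derivative of the vorticity function. -/
noncomputable def ddγ (s : ℝ) : ℝ :=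
  derivWithin (derivWithin W.γ (Icc 0 W.m)) (Icc 0 W.m) s

theorem contDiffOn_dγ : ContDiffOn ℝ 1 W.dγ (Icc 0 W.m) :=
  W.γ_smooth.derivWithin (uniqueDiffOn_Icc W.m_pos) (by norm_num)

theorem hasDerivAt_γ {s : ℝ} (hs : s ∈ Ioo 0 W.m) : HasDerivAt W.γ (W.dγ s) s :=
  (W.γ_smooth.differentiableOn (by norm_num) s (Ioo_subset_Icc_self hs)).hasDerivWithinAt.hasDerivAt
    (Icc_mem_nhds hs.1 hs.2)

theorem hasDerivAt_dγ {s : ℝ} (hs : s ∈ Ioo 0 W.m) : HasDerivAt W.dγ (W.ddγ s) s :=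
  (W.contDiffOn_dγ.differentiableOn (by norm_num) s
    (Ioo_subset_Icc_self hs)).hasDerivWithinAt.hasDerivAt (Icc_mem_nhds hs.1 hs.2)

theorem eventually_interiorX {x y : ℝ} (h1 : -W.d < y) (h2 : y < W.η x) :
    ∀ᶠ t in 𝓝 x, -W.d < y ∧ y < W.η t := by
  filter_upwards [W.continuous_η.continuousAt.eventually_const_lt h2] with t ht using ⟨h1, ht⟩

theorem eventually_interiorY {x y : ℝ} (h1 : -W.d < y) (h2 : y < W.η x) :
    ∀ᶠ t in 𝓝 y, -W.d < t ∧ t < W.η x :=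
  Ioo_mem_nhds h1 h2

theorem incompressible_closed (hL : 0 < L) {x y : ℝ} (h1 : -W.d ≤ y) (h2 : y ≤ W.η x) :
    pdY W.v (x, y) = -pdX W.u (x, y) := by
  have h := eq_zero_of_eq_zero_Ioo (f := fun y => pdX W.u (x, y) + pdY W.v (x, y))
    ((W.contDiff_ux.continuous.comp (Continuous.prodMk_right x)).add
      (W.contDiff_vy.continuous.comp (Continuous.prodMk_right x)))
    (W.bed_lt_surface hL x) (fun y h h' => W.incompressible x y h h') h1 h2
  linarith

theorem vorticity_surface (hL : 0 < L) (x : ℝ) :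
    pdX W.v (x, W.η x) = pdY W.u (x, W.η x) + W.γ 0 := by
  have hb := W.bed_lt_surface hL x
  have hc : ContinuousWithinAt (fun y => W.γ (W.ψ (x, y))) (Ioo (-W.d) (W.η x)) (W.η x) := by
    refine ContinuousWithinAt.comp (t := Icc 0 W.m) (g := W.γ) ?_ ?_
      (fun y hy => Ioo_subset_Icc_self (W.psi_mem_Ioo hy.1 hy.2))
    · exact W.γ_smooth.continuousOn _ (by simp [W.psi_surface, W.m_pos.le])
    · exact (W.ψ_smooth.continuous.comp (Continuous.prodMk_right x)).continuousWithinAt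
  have hc' : ContinuousWithinAt (fun y => pdX W.v (x, y) - pdY W.u (x, y))
      (Ioo (-W.d) (W.η x)) (W.η x) :=
    ((W.contDiff_vx.continuous.comp (Continuous.prodMk_right x)).sub
      (W.contDiff_uy.continuous.comp (Continuous.prodMk_right x))).continuousWithinAt
  have hne : (𝓝[Ioo (-W.d) (W.η x)] (W.η x)).NeBot := by
    rw [← mem_closure_iff_nhdsWithin_neBot, closure_Ioo hb.ne]
    exact right_mem_Icc.2 hb.le
  have := tendsto_nhds_unique (Tendsto.congr' (f₂ := fun y => W.γ (W.ψ (x, y))) (by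
    filter_upwards [self_mem_nhdsWithin] with y hy using W.vorticity_eq x y hy.1 hy.2) hc') hc
  simp only [W.psi_surface] at this
  linarith

theorem psi_sliceX {x y : ℝ} (h1 : -W.d ≤ y) (h2 : y ≤ W.η x) :
    HasDerivAt (fun t => W.ψ (t, y)) (-W.v (x, y)) x := by
  rw [← W.psi_x x y h1 h2]
  exact hasDerivAt_sliceX (W.ψ_smooth.differentiable (by norm_num)) x y

theorem psi_sliceY {x y : ℝ} (h1 : -W.d ≤ y) (h2 : y ≤ W.η x) :
    HasDerivAt (fun t => W.ψ (x, t)) (W.u (x, y)) y := by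
  rw [← W.psi_y x y h1 h2]
  exact hasDerivAt_sliceY (W.ψ_smooth.differentiable (by norm_num)) x y

theorem uxx_add_vxy {x y : ℝ} (h1 : -W.d < y) (h2 : y < W.η x) :
    pdX (pdX W.u) (x, y) + pdX (pdY W.v) (x, y) = 0 := by
  refine ((hasDerivAt_sliceX (W.contDiff_ux.differentiable two_ne_zero) x y).fun_add
    (hasDerivAt_sliceX (W.contDiff_vy.differentiable two_ne_zero) x y)).unique ?_
  refine (hasDerivAt_const x (0 : ℝ)).congr_of_eventuallyEq ?_
  filter_upwards [W.eventually_interiorX h1 h2] with t ht using W.incompressible t y ht.1 ht.2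

theorem uxy_add_vyy {x y : ℝ} (h1 : -W.d < y) (h2 : y < W.η x) :
    pdY (pdX W.u) (x, y) + pdY (pdY W.v) (x, y) = 0 := by
  refine ((hasDerivAt_sliceY (W.contDiff_ux.differentiable two_ne_zero) x y).fun_add
    (hasDerivAt_sliceY (W.contDiff_vy.differentiable two_ne_zero) x y)).unique ?_
  refine (hasDerivAt_const y (0 : ℝ)).congr_of_eventuallyEq ?_
  filter_upwards [W.eventually_interiorY h1 h2] with t ht using W.incompressible x t ht.1 ht.2

theorem laplacian_u {x y : ℝ} (h1 : -W.d < y) (h2 : y < W.η x) :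
    pdX (pdX W.u) (x, y) + pdY (pdY W.u) (x, y) = -W.dγ (W.ψ (x, y)) * W.u (x, y) := by
  have h3 : pdY (pdX W.v) (x, y) - pdY (pdY W.u) (x, y)
      = W.dγ (W.ψ (x, y)) * W.u (x, y) := by
    refine ((hasDerivAt_sliceY (W.contDiff_vx.differentiable two_ne_zero) x y).fun_sub
      (hasDerivAt_sliceY (W.contDiff_uy.differentiable two_ne_zero) x y)).unique ?_
    refine (HasDerivAt.comp y (W.hasDerivAt_γ (W.psi_mem_Ioo h1 h2))
      (W.psi_sliceY h1.le h2.le)).congr_of_eventuallyEq ?_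
    filter_upwards [W.eventually_interiorY h1 h2] with t ht using W.vorticity_eq x t ht.1 ht.2
  have h4 := W.uxx_add_vxy h1 h2
  rw [pdX_pdY_comm (W.v_smooth.of_le (by norm_num))] at h4
  linarith

theorem laplacian_v {x y : ℝ} (h1 : -W.d < y) (h2 : y < W.η x) :
    pdX (pdX W.v) (x, y) + pdY (pdY W.v) (x, y) = -W.dγ (W.ψ (x, y)) * W.v (x, y) := by
  have h3 : pdX (pdX W.v) (x, y) - pdX (pdY W.u) (x, y)
      = W.dγ (W.ψ (x, y)) * -W.v (x, y) := by
    refine ((hasDerivAt_sliceX (W.contDiff_vx.differentiable two_ne_zero) x y).fun_sub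
      (hasDerivAt_sliceX (W.contDiff_uy.differentiable two_ne_zero) x y)).unique ?_
    refine (HasDerivAt.comp x (W.hasDerivAt_γ (W.psi_mem_Ioo h1 h2))
      (W.psi_sliceX h1.le h2.le)).congr_of_eventuallyEq ?_
    filter_upwards [W.eventually_interiorX h1 h2] with t ht using W.vorticity_eq t y ht.1 ht.2
  have h4 := W.uxy_add_vyy h1 h2
  rw [← pdX_pdY_comm (W.u_smooth.of_le (by norm_num))] at h4
  linarith

theorem laplacian_ux {x y : ℝ} (h1 : -W.d < y) (h2 : y < W.η x) :
    pdX (pdX (pdX W.u)) (x, y) + pdY (pdY (pdX W.u)) (x, y) =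
      W.ddγ (W.ψ (x, y)) * W.v (x, y) * W.u (x, y)
        - W.dγ (W.ψ (x, y)) * pdX W.u (x, y) := by
  have hxx : ContDiff ℝ 1 (pdX (pdX W.u)) := contDiff_pdX W.contDiff_ux (by norm_num)
  have hyy : ContDiff ℝ 1 (pdY (pdY W.u)) := contDiff_pdY W.contDiff_uy (by norm_num)
  rw [← pdX_pdY_comm (W.u_smooth.of_le (by norm_num)), ← pdX_pdY_comm W.contDiff_uy]
  have key := ((hasDerivAt_sliceX (hxx.differentiable one_ne_zero) x y).fun_add
    (hasDerivAt_sliceX (hyy.differentiable one_ne_zero) x y)).unique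
    ((((HasDerivAt.comp x (W.hasDerivAt_dγ (W.psi_mem_Ioo h1 h2))
      (W.psi_sliceX h1.le h2.le)).fun_neg).fun_mul
      (hasDerivAt_sliceX W.differentiable_u x y)).congr_of_eventuallyEq (by
        filter_upwards [W.eventually_interiorX h1 h2] with t ht using
          W.laplacian_u ht.1 ht.2))
  rw [key]
  simp only [Function.comp]
  ring

theorem laplacian_u_nonpos (hL : 0 < L) (hγ : ∀ s ∈ Icc (0:ℝ) W.m, W.dγ s ≤ 0)
    {x y : ℝ} (h1 : -W.d ≤ y) (h2 : y ≤ W.η x) :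
    pdX (pdX W.u) (x, y) + pdY (pdY W.u) (x, y) ≤ 0 := by
  have hxx : ContDiff ℝ 1 (pdX (pdX W.u)) := contDiff_pdX W.contDiff_ux (by norm_num)
  have hyy : ContDiff ℝ 1 (pdY (pdY W.u)) := contDiff_pdY W.contDiff_uy (by norm_num)
  refine nonpos_of_nonpos_Ioo
    (f := fun y => pdX (pdX W.u) (x, y) + pdY (pdY W.u) (x, y))
    ((hxx.continuous.comp (Continuous.prodMk_right x)).add
      (hyy.continuous.comp (Continuous.prodMk_right x)))
    (W.bed_lt_surface hL x) (fun y h h' => ?_) h1 h2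
  rw [W.laplacian_u h h']
  have := hγ _ (Ioo_subset_Icc_self (W.psi_mem_Ioo h h'))
  have := W.u_neg h.le h'.le
  nlinarith

theorem vxy_closed (hL : 0 < L) {x y : ℝ} (h1 : -W.d ≤ y) (h2 : y ≤ W.η x) :
    pdX (pdY W.v) (x, y) = -pdX (pdX W.u) (x, y) := by
  have hxx : ContDiff ℝ 1 (pdX (pdX W.u)) := contDiff_pdX W.contDiff_ux (by norm_num)
  have hxy : ContDiff ℝ 1 (pdX (pdY W.v)) := contDiff_pdX W.contDiff_vy (by norm_num)
  have h := eq_zero_of_eq_zero_Ioo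
    (f := fun y => pdX (pdX W.u) (x, y) + pdX (pdY W.v) (x, y))
    ((hxx.continuous.comp (Continuous.prodMk_right x)).add
      (hxy.continuous.comp (Continuous.prodMk_right x)))
    (W.bed_lt_surface hL x) (fun y h h' => W.uxx_add_vxy h h') h1 h2
  linarith

/-! ### Symmetry -/

theorem v_zero (y : ℝ) : W.v (0, y) = 0 := by
  have := W.v_odd 0 y
  rw [neg_zero] at this
  linarith

theorem v_L (y : ℝ) : W.v (L, y) = 0 := by
  have h1 := W.v_odd L y
  have h2 := W.v_periodic (-L) y
  rw [show -L + 2 * L = L by ring] at h2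
  linarith

theorem ux_odd (x y : ℝ) : pdX W.u (-x, y) = -pdX W.u (x, y) := by
  have h1 := hasDerivAt_sliceX W.differentiable_u x y
  have h2 : HasDerivAt (fun t => W.u (-t, y)) (pdX W.u (-x, y) * -1) x :=
    HasDerivAt.comp x (hasDerivAt_sliceX W.differentiable_u (-x) y) (hasDerivAt_neg x)
  have h3 := (h2.congr_of_eventuallyEq
    (Eventually.of_forall fun t => (W.u_even t y).symm)).unique h1
  linarith

theorem ux_periodic (x y : ℝ) : pdX W.u (x + 2 * L, y) = pdX W.u (x, y) := by
  have h1 := hasDerivAt_sliceX W.differentiable_u x y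
  have h2 : HasDerivAt (fun t => W.u (t + 2 * L, y)) (pdX W.u (x + 2 * L, y)) x :=
    (hasDerivAt_sliceX W.differentiable_u (x + 2 * L) y).comp_add_const x (2 * L)
  exact (h2.congr_of_eventuallyEq
    (Eventually.of_forall fun t => (W.u_periodic t y).symm)).unique h1

theorem ux_zero (y : ℝ) : pdX W.u (0, y) = 0 := by
  have := W.ux_odd 0 y
  rw [neg_zero] at this
  linarith

theorem ux_L (y : ℝ) : pdX W.u (L, y) = 0 := by
  have h1 := W.ux_odd L y
  have h2 := W.ux_periodic (-L) y
  rw [show -L + 2 * L = L by ring] at h2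
  linarith

theorem vxx_zero (y : ℝ) : pdX (pdX W.v) (0, y) = 0 := by
  have he : ∀ x, pdX W.v (-x, y) = pdX W.v (x, y) := fun x => by
    have h1 := hasDerivAt_sliceX W.differentiable_v x y
    have h2 : HasDerivAt (fun t => W.v (-t, y)) (pdX W.v (-x, y) * -1) x :=
      HasDerivAt.comp x (hasDerivAt_sliceX W.differentiable_v (-x) y) (hasDerivAt_neg x)
    have h3 := (h2.congr_of_eventuallyEq (f₁ := fun t => -W.v (t, y))
      (Eventually.of_forall fun t => (W.v_odd t y).symm)).unique h1.fun_neg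
    linarith
  have hd := W.contDiff_vx.differentiable two_ne_zero
  have h1 := hasDerivAt_sliceX hd 0 y
  have h2 : HasDerivAt (fun t => pdX W.v (-t, y)) (pdX (pdX W.v) (-0, y) * -1) 0 :=
    HasDerivAt.comp 0 (hasDerivAt_sliceX hd (-0) y) (hasDerivAt_neg 0)
  have h3 := (h2.congr_of_eventuallyEq (Eventually.of_forall fun t => (he t).symm)).unique h1
  rw [neg_zero] at h3
  linarith

theorem vy_zero (y : ℝ) : pdY W.v (0, y) = 0 :=
  (hasDerivAt_sliceY W.differentiable_v 0 y).unique
    ((hasDerivAt_const y (0 : ℝ)).congr_of_eventuallyEq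
      (Eventually.of_forall fun t => W.v_zero t))

theorem vyy_zero (y : ℝ) : pdY (pdY W.v) (0, y) = 0 :=
  (hasDerivAt_sliceY (W.contDiff_vy.differentiable two_ne_zero) 0 y).unique
    ((hasDerivAt_const y (0 : ℝ)).congr_of_eventuallyEq
      (Eventually.of_forall fun t => W.vy_zero t))

theorem uxy_zero (y : ℝ) : pdY (pdX W.u) (0, y) = 0 :=
  (hasDerivAt_sliceY (W.contDiff_ux.differentiable two_ne_zero) 0 y).unique
    ((hasDerivAt_const y (0 : ℝ)).congr_of_eventuallyEq
      (Eventually.of_forall fun t => W.ux_zero t))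

/-! ### The free surface -/

theorem hasDerivAt_surface {f : ℝ × ℝ → ℝ} (hf : Differentiable ℝ f) (x : ℝ) :
    HasDerivAt (fun t => f (t, W.η t))
      (pdX f (x, W.η x) + deriv W.η x * pdY f (x, W.η x)) x :=
  hasDerivAt_graph hf (W.differentiable_η x).hasDerivAt

/-- The quantity `G = u (u_y + v_x) + g` on the free surface. -/
noncomputable def G (x : ℝ) : ℝ :=
  W.u (x, W.η x) * (pdY W.u (x, W.η x) + pdX W.v (x, W.η x)) + g

theorem G_eq (hL : 0 < L) (x : ℝ) :
    W.G x = W.u (x, W.η x) * (2 * pdY W.u (x, W.η x) + W.γ 0) + g := by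
  rw [G, W.vorticity_surface hL]
  ring

theorem surface_identity (hL : 0 < L) (x : ℝ) :
    (W.u (x, W.η x) ^ 2 - W.v (x, W.η x) ^ 2) * pdX W.u (x, W.η x)
      + W.v (x, W.η x) * W.G x = 0 := by
  have hb := W.bed_lt_surface hL x
  have hPd : Differentiable ℝ W.P := W.P_smooth.differentiable (by norm_num)
  have hPX : ContDiff ℝ 2 (pdX W.P) := contDiff_pdX W.P_smooth (by norm_num)
  have hPY : ContDiff ℝ 2 (pdY W.P) := contDiff_pdY W.P_smooth (by norm_num)
  have hP : pdX W.P (x, W.η x) + deriv W.η x * pdY W.P (x, W.η x) = 0 :=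
    (W.hasDerivAt_surface hPd x).unique ((hasDerivAt_const x Patm).congr_of_eventuallyEq
      (Eventually.of_forall fun t => W.surface_pressure t))
  have cu := W.u_smooth.continuous
  have cv := W.v_smooth.continuous
  have cux := W.contDiff_ux.continuous
  have cuy := W.contDiff_uy.continuous
  have cvx := W.contDiff_vx.continuous
  have cvy := W.contDiff_vy.continuous
  have cPx := hPX.continuous
  have cPy := hPY.continuous
  have e1 := eq_zero_of_eq_zero_Ioo (f := fun y => W.u (x, y) * pdX W.u (x, y)
      + W.v (x, y) * pdY W.u (x, y) + pdX W.P (x, y)) (by fun_prop) hb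
    (fun y h h' => by linarith [W.euler_x x y h h']) hb.le le_rfl
  have e2 := eq_zero_of_eq_zero_Ioo (f := fun y => W.u (x, y) * pdX W.v (x, y)
      + W.v (x, y) * pdY W.v (x, y) + pdY W.P (x, y) + g) (by fun_prop) hb
    (fun y h h' => by linarith [W.euler_y x y h h']) hb.le le_rfl
  rw [W.incompressible_closed hL hb.le le_rfl] at e2
  have hk := W.surface_kinematic x
  rw [G]
  linear_combination W.u (x, W.η x) * e1 + W.v (x, W.η x) * e2 - W.u (x, W.η x) * hP
    - pdY W.P (x, W.η x) * hk

theorem deriv_η_eq (hL : 0 < L) (x : ℝ) :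
    deriv W.η x = W.v (x, W.η x) / W.u (x, W.η x) := by
  rw [eq_div_iff (W.u_neg (W.bed_lt_surface hL x).le le_rfl).ne]
  exact (W.surface_kinematic x).symm

/-! ### Waves satisfying the monotonicity condition -/

section Monotone

variable {W}

theorem v_nonneg (hM : W.MonotoneHalf) {x y : ℝ} (h1 : 0 ≤ x) (h2 : x ≤ L) (h3 : -W.d ≤ y)
    (h4 : y ≤ W.η x) : 0 ≤ W.v (x, y) := by
  rcases h1.eq_or_lt with rfl | h1
  · rw [W.v_zero]
  rcases h2.eq_or_lt with rfl | h2
  · rw [W.v_L]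
  rcases h3.eq_or_lt with rfl | h3
  · rw [W.bed_kinematic]
  rcases h4.eq_or_lt with rfl | h4
  · exact (hM _ (Or.inr ⟨h1, h2, rfl⟩)).le
  · exact (hM _ (Or.inl ⟨h1, h2, h3, h4⟩)).le

theorem deriv_η_nonpos (hL : 0 < L) (hM : W.MonotoneHalf) {x : ℝ} (h1 : 0 ≤ x) (h2 : x ≤ L) :
    deriv W.η x ≤ 0 := by
  have hb := W.bed_lt_surface hL x
  rw [W.deriv_η_eq hL]
  exact div_nonpos_of_nonneg_of_nonpos (W.v_nonneg hM h1 h2 hb.le le_rfl)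
    (W.u_neg hb.le le_rfl).le

/-- If `u_x ≤ 0` on the surface then the slope of the surface is less than `1`. -/
theorem sq_v_lt_sq_u_surface (hL : 0 < L) (hM : W.MonotoneHalf)
    (hγ : ∀ s ∈ Icc (0:ℝ) W.m, W.γ s ≤ 0)
    (hux : ∀ x, 0 ≤ x → x ≤ L → pdX W.u (x, W.η x) ≤ 0) {x : ℝ} (h1 : 0 ≤ x) (h2 : x ≤ L) :
    W.v (x, W.η x) ^ 2 < W.u (x, W.η x) ^ 2 := by
  have hd : ∀ x, HasDerivAt (fun t => W.u (t, W.η t) ^ 2 - W.v (t, W.η t) ^ 2) _ x := fun x =>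
    ((W.hasDerivAt_surface W.differentiable_u x).fun_pow 2).fun_sub
      ((W.hasDerivAt_surface W.differentiable_v x).fun_pow 2)
  have hmono : MonotoneOn (fun t => W.u (t, W.η t) ^ 2 - W.v (t, W.η t) ^ 2) (Icc 0 L) := by
    refine monotoneOn_of_deriv_nonneg (convex_Icc _ _)
      (fun t _ => (hd t).continuousAt.continuousWithinAt)
      (fun t _ => (hd t).differentiableAt.differentiableWithinAt) fun t ht => ?_
    rw [interior_Icc] at ht
    have hb := W.bed_lt_surface hL t
    have hu := W.u_neg hb.le le_rfl
    have hv := W.v_nonneg hM ht.1.le ht.2.le hb.le le_rfl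
    have ha := hux t ht.1.le ht.2.le
    have hγ0 := hγ 0 ⟨le_rfl, W.m_pos.le⟩
    rw [(hd t).deriv, W.deriv_η_eq hL, W.vorticity_surface hL,
      W.incompressible_closed hL hb.le le_rfl]
    have key : ∀ u v a b c : ℝ, u < 0 →
        (2 : ℕ) * u ^ (2 - 1) * (a + v / u * b) - (2 : ℕ) * v ^ (2 - 1) * (b + c + v / u * -a)
          = 2 * (u ^ 2 + v ^ 2) * (a / u) + 2 * v * -c := by
      intro u v a b c hu
      have := hu.ne
      field_simp
      push_cast
      ring
    rw [key _ _ _ _ _ hu]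
    have := div_nonneg_of_nonpos ha hu.le
    have : 0 ≤ -W.γ 0 := by linarith
    positivity
  have h0 := hmono ⟨le_rfl, hL.le⟩ ⟨h1, h2⟩ h1
  simp only [W.v_zero] at h0
  have := W.u_neg (W.bed_lt_surface hL 0).le le_rfl
  nlinarith

/-- A surface slope bound `v < |u|` propagates to the whole fluid. -/
theorem v_lt_neg_u (hL : 0 < L) (hdγ : ∀ s ∈ Icc (0:ℝ) W.m, W.dγ s ≤ 0)
    (hs : ∀ x, 0 ≤ x → x ≤ L → W.v (x, W.η x) < -W.u (x, W.η x)) {x y : ℝ}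
    (h1 : 0 ≤ x) (h2 : x ≤ L) (h3 : -W.d ≤ y) (h4 : y ≤ W.η x) :
    W.v (x, y) < -W.u (x, y) := by
  have cη := W.continuous_η
  have cu := W.u_smooth.continuous
  have cv := W.v_smooth.continuous
  have hun : ∀ x, W.u (x, W.η x) < 0 := fun x => W.u_neg (W.bed_lt_surface hL x).le le_rfl
  obtain ⟨x0, hx0, hmax⟩ := (isCompact_Icc (a := 0) (b := L)).exists_isMaxOn
    ⟨0, le_rfl, hL.le⟩ (f := fun x => W.v (x, W.η x) / -W.u (x, W.η x))
    (Continuous.continuousOn (Continuous.div (by fun_prop) (by fun_prop)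
      fun x => neg_ne_zero.2 (hun x).ne))
  set c := W.v (x0, W.η x0) / -W.u (x0, W.η x0) with hc
  have hc1 : c < 1 := by
    rw [hc, div_lt_one (neg_pos.2 (hun x0))]
    exact hs x0 hx0.1 hx0.2
  have hc0 : 0 ≤ c := by
    have : W.v (0, W.η 0) / -W.u (0, W.η 0) ≤ c := hmax ⟨le_rfl, hL.le⟩
    simpa [W.v_zero] using this
  have hu := W.u_neg h3 h4
  have hxx := W.contDiff_ux.differentiable two_ne_zero
  have hyy := W.contDiff_uy.differentiable two_ne_zero
  have hvxx := W.contDiff_vx.differentiable two_ne_zero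
  have hvyy := W.contDiff_vy.differentiable two_ne_zero
  have := weak_maximum_principle cη (a := 0) (b := L) (c := -W.d)
    (z := fun x y => W.v (x, y) + c * W.u (x, y)) (by fun_prop)
    (fun x y => (hasDerivAt_sliceX W.differentiable_v x y).fun_add
      ((hasDerivAt_sliceX W.differentiable_u x y).const_mul c))
    (fun x y => (hasDerivAt_sliceX hvxx x y).fun_add ((hasDerivAt_sliceX hxx x y).const_mul c))
    (fun x y => (hasDerivAt_sliceY W.differentiable_v x y).fun_add
      ((hasDerivAt_sliceY W.differentiable_u x y).const_mul c))
    (fun x y => (hasDerivAt_sliceY hvyy x y).fun_add ((hasDerivAt_sliceY hyy x y).const_mul c))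
    (fun x y _ _ g3 g4 hpos => by
      have e1 := W.laplacian_u g3 g4
      have e2 := W.laplacian_v g3 g4
      have e3 := hdγ _ (Ioo_subset_Icc_self (W.psi_mem_Ioo g3 g4))
      have : pdX (pdX W.v) (x, y) + c * pdX (pdX W.u) (x, y)
          + (pdY (pdY W.v) (x, y) + c * pdY (pdY W.u) (x, y))
          = -W.dγ (W.ψ (x, y)) * (W.v (x, y) + c * W.u (x, y)) := by
        linear_combination e2 + c * e1
      rw [this]
      exact mul_nonneg (neg_nonneg.2 e3) hpos.le)
    (fun y g3 g4 => by
      rw [W.v_zero, zero_add]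
      exact mul_nonpos_of_nonneg_of_nonpos hc0 (W.u_neg g3 g4).le)
    (fun y g3 g4 => by
      rw [W.v_L, zero_add]
      exact mul_nonpos_of_nonneg_of_nonpos hc0 (W.u_neg g3 g4).le)
    (fun x _ _ => by
      rw [W.bed_kinematic, zero_add]
      exact mul_nonpos_of_nonneg_of_nonpos hc0
        (W.u_neg le_rfl (W.bed_lt_surface hL x).le).le)
    (fun x g1 g2 _ => by
      have : W.v (x, W.η x) / -W.u (x, W.η x) ≤ c := hmax ⟨g1, g2⟩
      rw [div_le_iff₀ (neg_pos.2 (hun x))] at this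
      linarith)
    h1 h2 h3 h4
  nlinarith

/-- If `u_x ≤ 0` on the surface then `u_x ≤ 0` in the half period of the fluid. -/
theorem ux_nonpos (hL : 0 < L) (hM : W.MonotoneHalf)
    (hdγ : ∀ s ∈ Icc (0:ℝ) W.m, W.dγ s ≤ 0) (hddγ : ∀ s ∈ Icc (0:ℝ) W.m, W.ddγ s ≤ 0)
    (hux : ∀ x, 0 ≤ x → x ≤ L → pdX W.u (x, W.η x) ≤ 0) {x y : ℝ}
    (h1 : 0 ≤ x) (h2 : x ≤ L) (h3 : -W.d ≤ y) (h4 : y ≤ W.η x) :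
    pdX W.u (x, y) ≤ 0 := by
  have hx := W.contDiff_ux.differentiable two_ne_zero
  have hxx : ContDiff ℝ 1 (pdX (pdX W.u)) := contDiff_pdX W.contDiff_ux (by norm_num)
  have hxy : ContDiff ℝ 1 (pdY (pdX W.u)) := contDiff_pdY W.contDiff_ux (by norm_num)
  refine weak_maximum_principle W.continuous_η (a := 0) (b := L) (c := -W.d)
    (z := fun x y => pdX W.u (x, y)) W.contDiff_ux.continuous
    (hasDerivAt_sliceX hx) (hasDerivAt_sliceX (hxx.differentiable one_ne_zero))
    (hasDerivAt_sliceY hx) (hasDerivAt_sliceY (hxy.differentiable one_ne_zero))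
    (fun x y g1 g2 g3 g4 hpos => ?_) (fun y _ _ => (W.ux_zero y).le) (fun y _ _ => (W.ux_L y).le)
    (fun x g1 g2 => ?_) (fun x g1 g2 _ => hux x g1 g2) h1 h2 h3 h4
  · rw [W.laplacian_ux g3 g4]
    have hm := Ioo_subset_Icc_self (W.psi_mem_Ioo g3 g4)
    have e1 := hdγ _ hm
    have e2 := hddγ _ hm
    have e3 := W.v_nonneg hM g1.le g2.le g3.le g4.le
    have e4 := W.u_neg g3.le g4.le
    have := mul_nonneg (mul_nonneg (neg_nonneg.2 e2) e3) (neg_nonneg.2 e4.le)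
    nlinarith [mul_nonneg (neg_nonneg.2 e1) hpos.le]
  · have hb := W.bed_lt_surface hL x
    have := (hasDerivAt_sliceY W.differentiable_v x (-W.d)).nonneg_of_eventually_right (by
      filter_upwards [Ioo_mem_nhdsGT hb] with t ht
      rw [W.bed_kinematic]
      exact W.v_nonneg hM g1 g2 ht.1.le ht.2.le)
    rw [W.incompressible_closed hL le_rfl hb.le] at this
    linarith

/-- Some point of the surface satisfies a quantitative lower bound for `v_y / v`. -/
theorem exists_vy_ge (hL : 0 < L) (hM : W.MonotoneHalf)
    (hdγ : ∀ s ∈ Icc (0:ℝ) W.m, W.dγ s ≤ 0) :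
    ∃ x, 0 < x ∧ x < L ∧
      Real.pi / (4 * L) * W.v (x, W.η x) ≤ pdY W.v (x, W.η x) := by
  have cη := W.continuous_η
  have cv := W.v_smooth.continuous
  set μ := Real.pi / (2 * L) with hμ
  set κ := Real.pi / (4 * L) with hκ
  have hκ0 : 0 < κ := by positivity
  have hμκ : μ = 2 * κ := by rw [hμ, hκ]; field_simp; norm_num
  set φ : ℝ → ℝ → ℝ := fun x y => Real.cos (μ * (x - L / 2)) * Real.exp (κ * y) with hφ
  have hφpos : ∀ x y, 0 ≤ x → x ≤ L → 0 < φ x y := by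
    intro x y h1 h2
    refine mul_pos (Real.cos_pos_of_mem_Ioo ?_) (Real.exp_pos _)
    have hπ := Real.pi_pos
    have : μ * L = Real.pi / 2 := by rw [hμ]; field_simp
    have hμ0 : 0 < μ := by positivity
    constructor <;> nlinarith
  have hb := W.bed_lt_surface hL
  obtain ⟨⟨x, y⟩, ⟨h1, h2, h3, h4⟩, hmax⟩ :=
    (isCompact_subgraph cη 0 L (-W.d)).exists_isMaxOn
      ⟨(0, W.η 0), le_rfl, hL.le, (hb 0).le, le_rfl⟩
      (f := fun p => W.v p / φ p.1 p.2) (ContinuousOn.div cv.continuousOn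
        (Continuous.continuousOn (by fun_prop)) fun p hp => (hφpos _ _ hp.1 hp.2.1).ne')
  simp only at h1 h2 h3 h4
  set s := W.v (x, y) / φ x y with hs
  have hle : ∀ x' y', 0 ≤ x' → x' ≤ L → -W.d ≤ y' → y' ≤ W.η x' →
      W.v (x', y') - s * φ x' y' ≤ 0 := fun x' y' g1 g2 g3 g4 => by
    have : W.v (x', y') / φ x' y' ≤ s :=
      hmax (show (x', y') ∈ _ from ⟨g1, g2, g3, g4⟩)
    rw [div_le_iff₀ (hφpos _ _ g1 g2)] at this
    linarith
  have hz0 : W.v (x, y) - s * φ x y = 0 := by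
    rw [hs, div_mul_cancel₀ _ (hφpos x y h1 h2).ne', sub_self]
  have hspos : 0 < s := by
    have e1 := hle (L / 2) (W.η (L / 2)) (by linarith) (by linarith) (hb _).le le_rfl
    have e2 := hM (L / 2, W.η (L / 2)) (Or.inr ⟨by simp; linarith, by simp; linarith, rfl⟩)
    have e3 := hφpos (L / 2) (W.η (L / 2)) (by linarith) (by linarith)
    by_contra! hn
    nlinarith
  have hvpos : 0 < W.v (x, y) := by
    have := mul_pos hspos (hφpos x y h1 h2)
    linarith
  have g1 : 0 < x := h1.lt_of_ne fun h => by
    rw [← h, W.v_zero] at hvpos; exact lt_irrefl _ hvpos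
  have g2 : x < L := h2.lt_of_ne fun h => by
    rw [h, W.v_L] at hvpos; exact lt_irrefl _ hvpos
  have g3 : -W.d < y := h3.lt_of_ne fun h => by
    rw [← h, W.bed_kinematic] at hvpos; exact lt_irrefl _ hvpos
  have dx : ∀ x y, HasDerivAt (fun t => φ t y)
      (-μ * Real.sin (μ * (x - L / 2)) * Real.exp (κ * y)) x := fun x y => by
    have := (((((hasDerivAt_id' x).sub_const (L / 2)).const_mul μ).cos).mul_const
      (Real.exp (κ * y)))
    exact this.congr_deriv (by ring)
  have dxx : ∀ x y, HasDerivAt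
      (fun t => -μ * Real.sin (μ * (t - L / 2)) * Real.exp (κ * y)) (-μ ^ 2 * φ x y) x :=
    fun x y => by
    have := ((((((hasDerivAt_id' x).sub_const (L / 2)).const_mul μ).sin).const_mul (-μ)).mul_const
      (Real.exp (κ * y)))
    exact this.congr_deriv (by simp only [hφ]; ring)
  have dy : ∀ x y, HasDerivAt (fun t => φ x t) (κ * φ x y) y := fun x y => by
    have := (((hasDerivAt_id' y).const_mul κ).exp).const_mul (Real.cos (μ * (x - L / 2)))
    exact this.congr_deriv (by simp only [hφ]; ring)
  rcases h4.eq_or_lt with h4 | g4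
  · subst h4
    refine ⟨x, g1, g2, ?_⟩
    have := ((hasDerivAt_sliceY W.differentiable_v x (W.η x)).fun_sub
      ((dy x (W.η x)).const_mul s)).nonneg_of_eventually_left (by
        filter_upwards [Ioo_mem_nhdsLT (hb x)] with t ht
        rw [hz0]
        exact hle x t h1 h2 ht.1.le ht.2.le)
    have e : W.v (x, W.η x) = s * φ x (W.η x) := by linarith
    rw [e]
    linarith
  · exfalso
    have hvxx := W.contDiff_vx.differentiable two_ne_zero
    have hvyy := W.contDiff_vy.differentiable two_ne_zero
    have := laplacian_nonpos_of_isMax cη (a := 0) (b := L) (c := -W.d)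
      (z := fun x y => W.v (x, y) - s * φ x y)
      (fun x y => (hasDerivAt_sliceX W.differentiable_v x y).fun_sub ((dx x y).const_mul s))
      (fun x y => (hasDerivAt_sliceX hvxx x y).fun_sub ((dxx x y).const_mul s))
      (fun x y => (hasDerivAt_sliceY W.differentiable_v x y).fun_sub ((dy x y).const_mul s))
      (fun x y => (hasDerivAt_sliceY hvyy x y).fun_sub (((dy x y).const_mul κ).const_mul s))
      g1 g2 g3 g4 (fun x' y' i1 i2 i3 i4 => by
        rw [hz0]; exact hle x' y' i1.le i2.le i3.le i4.le)
    have e1 := W.laplacian_v g3 g4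
    have e2 := hdγ _ (Ioo_subset_Icc_self (W.psi_mem_Ioo g3 g4))
    have e3 := mul_nonneg (neg_nonneg.2 e2) hvpos.le
    have e4 : 0 < κ ^ 2 * (s * φ x y) :=
      mul_pos (by positivity) (mul_pos hspos (hφpos x y h1 h2))
    rw [hμκ] at this
    nlinarith

end Monotone

section Endpoint

variable {W}

theorem hasDerivAt_G (hL : 0 < L) (x : ℝ) :
    HasDerivAt W.G
      ((pdX W.u (x, W.η x) + deriv W.η x * pdY W.u (x, W.η x))
          * (2 * pdY W.u (x, W.η x) + W.γ 0)
        + W.u (x, W.η x) * (2 * (pdX (pdY W.u) (x, W.η x)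
          + deriv W.η x * pdY (pdY W.u) (x, W.η x)))) x := by
  rw [show W.G = fun x => W.u (x, W.η x) * (2 * pdY W.u (x, W.η x) + W.γ 0) + g from
    funext (W.G_eq hL)]
  exact ((W.hasDerivAt_surface W.differentiable_u x).fun_mul
    (((W.hasDerivAt_surface (W.contDiff_uy.differentiable two_ne_zero) x).const_mul 2).add_const
      _)).add_const _

theorem continuous_G (hL : 0 < L) : Continuous W.G :=
  continuous_iff_continuousAt.2 fun x => (W.hasDerivAt_G hL x).continuousAt

/-- The surface identity differentiated at a point where `v` and `u_x` vanish. -/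
theorem sq_u_mul_uxx_add (hL : 0 < L) {x : ℝ} (hv : W.v (x, W.η x) = 0)
    (hux : pdX W.u (x, W.η x) = 0) :
    W.u (x, W.η x) ^ 2 * pdX (pdX W.u) (x, W.η x) + pdX W.v (x, W.η x) * W.G x = 0 := by
  have h1 := ((((W.hasDerivAt_surface W.differentiable_u x).fun_pow 2).fun_sub
      ((W.hasDerivAt_surface W.differentiable_v x).fun_pow 2)).fun_mul
      (W.hasDerivAt_surface (W.contDiff_ux.differentiable two_ne_zero) x)).fun_add
      ((W.hasDerivAt_surface W.differentiable_v x).fun_mul (W.hasDerivAt_G hL x))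
  have h2 := h1.unique ((hasDerivAt_const x (0 : ℝ)).congr_of_eventuallyEq
    (Eventually.of_forall fun t => W.surface_identity hL t))
  have h3 : deriv W.η x = 0 := by rw [W.deriv_η_eq hL, hv, zero_div]
  rw [hv, hux, h3] at h2
  linear_combination h2

theorem surface_le_crest (hL : 0 < L) (hM : W.MonotoneHalf) {x : ℝ} (h1 : 0 ≤ x) (h2 : x ≤ L) :
    W.η x ≤ W.η 0 := by
  refine antitoneOn_of_deriv_nonpos (convex_Icc 0 L) W.continuous_η.continuousOn
    W.differentiable_η.differentiableOn (fun t ht => ?_) ⟨le_rfl, hL.le⟩ ⟨h1, h2⟩ h1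
  rw [interior_Icc] at ht
  exact W.deriv_η_nonpos hL hM ht.1.le ht.2.le

theorem exists_crest_sub_le (hL : 0 < L) :
    ∃ K, 1 ≤ K ∧ ∀ x, 0 ≤ x → x ≤ L → W.η 0 - W.η x ≤ K * x ^ 2 := by
  have h1 : ContDiff ℝ 3 (deriv W.η) := (contDiff_succ_iff_deriv.1
    (show ContDiff ℝ (3 + 1) W.η from W.η_smooth.of_le (by norm_num))).2.2
  have h2 : ContDiff ℝ 2 (deriv (deriv W.η)) := (contDiff_succ_iff_deriv.1
    (show ContDiff ℝ (2 + 1) (deriv W.η) from h1.of_le (by norm_num))).2.2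
  obtain ⟨K, hK⟩ := (isCompact_Icc (a := 0) (b := L)).exists_bound_of_continuousOn
    h2.continuous.continuousOn
  have hd0 : deriv W.η 0 = 0 := by rw [W.deriv_η_eq hL, W.v_zero, zero_div]
  refine ⟨max 1 K, le_max_left _ _, fun x g1 g2 => ?_⟩
  have h3 : ∀ t ∈ Icc 0 x, ‖deriv W.η t‖ ≤ max 1 K * x := fun t ht => by
    have := (convex_Icc 0 L).norm_image_sub_le_of_norm_deriv_le
      (fun s _ => h1.differentiable (by norm_num) s) hK ⟨le_rfl, hL.le⟩ ⟨ht.1, ht.2.trans g2⟩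
    rw [hd0, sub_zero, sub_zero, Real.norm_of_nonneg ht.1] at this
    refine this.trans (mul_le_mul (le_max_right _ _) ht.2 ht.1 (by positivity))
  have h4 := (convex_Icc 0 x).norm_image_sub_le_of_norm_deriv_le
    (fun s _ => W.differentiable_η s) h3 ⟨le_rfl, g1⟩ ⟨g1, le_rfl⟩
  rw [sub_zero, Real.norm_of_nonneg g1, Real.norm_eq_abs] at h4
  have := neg_abs_le (W.η x - W.η 0)
  nlinarith

set_option maxHeartbeats 1000000 in
/-- A lower barrier for `v` near the crest, along the diagonal below it. -/
theorem exists_crest_barrier (hL : 0 < L) (hM : W.MonotoneHalf) :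
    ∃ ε > 0, ∃ c, ∀ᶠ x in 𝓝[>] (0:ℝ),
      ε * (x ^ 2 + c * x ^ 3) ≤ W.v (x, W.η 0 - x) := by
  obtain ⟨K, hK1, hK⟩ := W.exists_crest_sub_le hL
  obtain ⟨C, hC⟩ := isCompact_Icc.exists_bound_of_continuousOn W.contDiffOn_dγ.continuousOn
  set A := 6 * K + 1 with hA
  set H := W.η 0 with hH
  have hb := W.bed_lt_surface hL
  have hbH : 0 < H + W.d := by have := hb 0; simp only [← hH] at this; linarith
  have hC0 : 0 ≤ C := (norm_nonneg _).trans (hC 0 ⟨le_rfl, W.m_pos.le⟩)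
  have hApos : 0 < A := by linarith
  obtain ⟨r, hr, hr'⟩ := exists_between (lt_min one_pos (lt_min hbH (lt_min hL
    (show 0 < 1 / ((C + 1) * (5 + A)) by positivity))))
  simp only [lt_min_iff] at hr'
  obtain ⟨hr1, hrH, hrL, hrC⟩ := hr'
  rw [lt_div_iff₀ (by positivity)] at hrC
  have hrA : (5 + A) * r ≤ 1 := by
    nlinarith [mul_nonneg hC0 (mul_pos (show 0 < 5 + A by linarith) hr).le]
  have hrC' : C * ((5 + A) * r) ≤ 1 := by nlinarith
  obtain ⟨ρ, hρdef⟩ : ∃ ρ, ρ = r ^ 2 / (6 + A) := ⟨_, rfl⟩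
  have hρ : 0 < ρ := by rw [hρdef]; positivity
  have hρA : ρ * (6 + A) = r ^ 2 := by rw [hρdef]; field_simp
  have hρr : ρ ≤ r := by nlinarith
  have hρL : ρ < L := hρr.trans_lt hrL
  have hKρ : ∀ x, 0 ≤ x → x ≤ ρ → H - r ≤ W.η x := fun x h1 h2 => by
    have := hK x h1 (h2.trans hρL.le)
    nlinarith [mul_le_mul h2 h2 h1 hρ.le, mul_pos hρ hρ]
  obtain ⟨v0, hv0, hv⟩ := (isCompact_Icc (a := H - r) (b := W.η ρ)).exists_forall_le'
    (f := fun y => W.v (ρ, y)) (a := 0)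
    (W.v_smooth.continuous.comp (Continuous.prodMk_right ρ)).continuousOn (fun y hy => by
      rcases hy.2.eq_or_lt with h | h
      · exact hM _ (Or.inr ⟨hρ, hρL, h⟩)
      · exact hM _ (Or.inl ⟨hρ, hρL, by show -W.d < y; linarith [hy.1], h⟩))
  set ε := v0 / (6 + A) with hε
  have hεpos : 0 < ε := by positivity
  have hεA : ε * (6 + A) = v0 := by rw [hε]; field_simp
  have hle : ∀ x y, 0 ≤ x → x ≤ ρ → H - r ≤ y → y ≤ W.η x → 0 ≤ H - y ∧ H - y ≤ r := by
    intro x y h1 h2 h3 h4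
    have := W.surface_le_crest hL hM h1 (h2.trans hρL.le)
    constructor <;> linarith
  -- the positive part of the barrier
  have hpos : ∀ x Y, 0 ≤ x → x ≤ ρ → 0 ≤ Y → Y ≤ r →
      x * Y + 4 * x ^ 2 * Y + A * x * Y ^ 2 ≤ x * ((5 + A) * r) := by
    intro x Y h1 h2 h3 h4
    have e1 : x * Y ≤ r * 1 := by nlinarith
    have e2 : Y * Y ≤ r * 1 := by nlinarith
    have e3 : x * (x * Y) ≤ x * r := by nlinarith
    have e4 : A * x * (Y * Y) ≤ A * x * r := by
      have : 0 ≤ A * x := by positivity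
      nlinarith
    nlinarith
  set w : ℝ → ℝ → ℝ := fun x y => x * (H - y) + 4 * x ^ 2 * (H - y) + A * x * (H - y) ^ 2
    - (H - y) ^ 3 - 2 * K * x ^ 3 with hw
  have hx3 : ∀ x : ℝ, 0 ≤ x → 0 ≤ 2 * K * x ^ 3 := fun x hx => by positivity
  have cv := W.v_smooth.continuous
  have hvxx := W.contDiff_vx.differentiable two_ne_zero
  have hvyy := W.contDiff_vy.differentiable two_ne_zero
  have wx : ∀ x y, HasDerivAt (fun t => w t y)
      ((H - y) + 8 * x * (H - y) + A * (H - y) ^ 2 - 6 * K * x ^ 2) x := fun x y => by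
    have e := hasDerivAt_id' x
    refine (((((e.mul_const (H - y)).fun_add (((e.fun_pow 2).const_mul 4).mul_const (H - y))).fun_add
      ((e.const_mul A).mul_const ((H - y) ^ 2))).sub_const ((H - y) ^ 3)).fun_sub
      ((e.fun_pow 3).const_mul (2 * K))).congr_deriv ?_
    push_cast
    ring
  have wxx : ∀ x y, HasDerivAt
      (fun t => (H - y) + 8 * t * (H - y) + A * (H - y) ^ 2 - 6 * K * t ^ 2)
      (8 * (H - y) - 12 * K * x) x := fun x y => by
    have e := hasDerivAt_id' x
    refine (((((e.const_mul 8).mul_const (H - y)).const_add (H - y)).add_const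
      (A * (H - y) ^ 2)).fun_sub ((e.fun_pow 2).const_mul (6 * K))).congr_deriv ?_
    push_cast
    ring
  have wy : ∀ x y, HasDerivAt (fun t => w x t)
      (-x - 4 * x ^ 2 - 2 * A * x * (H - y) + 3 * (H - y) ^ 2) y := fun x y => by
    have e := (hasDerivAt_id' y).const_sub H
    refine (((((e.const_mul x).fun_add (e.const_mul (4 * x ^ 2))).fun_add
      ((e.fun_pow 2).const_mul (A * x))).fun_sub (e.fun_pow 3)).sub_const
      (2 * K * x ^ 3)).congr_deriv ?_
    push_cast
    ring
  have wyy : ∀ x y, HasDerivAt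
      (fun t => -x - 4 * x ^ 2 - 2 * A * x * (H - t) + 3 * (H - t) ^ 2)
      (2 * A * x - 6 * (H - y)) y := fun x y => by
    have e := (hasDerivAt_id' y).const_sub H
    refine (((e.const_mul (2 * A * x)).const_sub (-x - 4 * x ^ 2)).fun_add
      ((e.fun_pow 2).const_mul 3)).congr_deriv ?_
    push_cast
    ring
  have key : ∀ x y, 0 ≤ x → x ≤ ρ → H - r ≤ y → y ≤ W.η x → ε * w x y - W.v (x, y) ≤ 0 := by
    intro x y h1 h2 h3 h4
    refine weak_maximum_principle W.continuous_η (a := 0) (b := ρ) (c := H - r)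
      (z := fun x y => ε * w x y - W.v (x, y)) (by simp only [hw]; fun_prop)
      (fun x y => ((wx x y).const_mul ε).fun_sub (hasDerivAt_sliceX W.differentiable_v x y))
      (fun x y => ((wxx x y).const_mul ε).fun_sub (hasDerivAt_sliceX hvxx x y))
      (fun x y => ((wy x y).const_mul ε).fun_sub (hasDerivAt_sliceY W.differentiable_v x y))
      (fun x y => ((wyy x y).const_mul ε).fun_sub (hasDerivAt_sliceY hvyy x y))
      (fun x y g1 g2 g3 g4 hz => ?_) (fun y g3 g4 => ?_) (fun y g3 g4 => ?_) (fun x g1 g2 => ?_)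
      (fun x g1 g2 g3 => ?_) h1 h2 h3 h4
    · obtain ⟨i1, i2⟩ := hle x y g1.le g2.le g3.le g4.le
      have hd : -W.d < y := by linarith
      have e1 := W.laplacian_v hd g4
      have hm := Ioo_subset_Icc_self (W.psi_mem_Ioo hd g4)
      have e2 := hC _ hm
      rw [Real.norm_eq_abs] at e2
      have e2' := neg_le_of_abs_le e2
      have e3 := W.v_nonneg hM g1.le (g2.le.trans hρL.le) hd.le g4.le
      have e4 := hpos x (H - y) g1.le g2.le i1 i2
      have e5 : w x y ≤ x * ((5 + A) * r) := by
        simp only [hw]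
        have := pow_nonneg i1 3
        linarith [hx3 x g1.le]
      have e6 : C * w x y ≤ x * 1 := by
        have i3 := mul_le_mul_of_nonneg_left e5 hC0
        have i4 := mul_le_mul_of_nonneg_left hrC' g1.le
        linarith
      have e7 : C * W.v (x, y) ≤ ε * x := by
        have : C * W.v (x, y) ≤ C * (ε * w x y) := mul_le_mul_of_nonneg_left (by linarith) hC0
        have := mul_le_mul_of_nonneg_left e6 hεpos.le
        linarith
      have e8 : ε * (8 * (H - y) - 12 * K * x) - pdX (pdX W.v) (x, y)
          + (ε * (2 * A * x - 6 * (H - y)) - pdY (pdY W.v) (x, y))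
          = ε * (2 * (H - y)) + 2 * (ε * x) + W.dγ (W.ψ (x, y)) * W.v (x, y) := by
        rw [hA]
        linear_combination -e1
      have e9 := mul_le_mul_of_nonneg_right e2' e3
      have e10 : 0 ≤ ε * (2 * (H - y)) := by positivity
      have e11 : 0 ≤ ε * x := by positivity
      linarith
    · rw [W.v_zero]
      have i1 := (hle 0 y le_rfl hρ.le g3 g4).1
      have : w 0 y = -(H - y) ^ 3 := by simp only [hw]; ring
      rw [this]
      have := mul_nonneg hεpos.le (pow_nonneg i1 3)
      linarith
    · obtain ⟨i1, i2⟩ := hle ρ y hρ.le le_rfl g3 g4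
      have e4 := hpos ρ (H - y) hρ.le le_rfl i1 i2
      have e5 : w ρ y ≤ 6 + A := by
        simp only [hw]
        have := pow_nonneg i1 3
        nlinarith [hx3 ρ hρ.le]
      have e6 : v0 ≤ W.v (ρ, y) := hv y ⟨g3, g4⟩
      have := mul_le_mul_of_nonneg_left e5 hεpos.le
      linarith
    · have e3 := W.v_nonneg hM g1 (g2.trans hρL.le) (by linarith) (hKρ x g1 g2)
      have e4 := hpos x r g1 g2 hr.le le_rfl
      have e5 : w x (H - r) ≤ 0 := by
        simp only [hw, sub_sub_cancel]
        have i1 : x * ((5 + A) * r) ≤ ρ * ((6 + A) * r) :=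
          mul_le_mul g2 (by nlinarith) (by positivity) hρ.le
        have i2 : ρ * ((6 + A) * r) = r ^ 3 := by linear_combination r * hρA
        linarith [hx3 x g1]
      have := mul_nonneg hεpos.le (neg_nonneg.2 e5)
      linarith
    · obtain ⟨i1, i2⟩ := hle x _ g1 g2 g3 le_rfl
      have e3 := W.v_nonneg hM g1 (g2.trans hρL.le) (hb x).le le_rfl
      have e4 := hK x g1 (g2.trans hρL.le)
      have e5 : w x (W.η x) ≤ 0 := by
        simp only [hw]
        set Y := H - W.η x
        have j1 : 1 + 4 * x + A * Y ≤ 2 := by nlinarith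
        have j2 : x * Y * (1 + 4 * x + A * Y) ≤ x * (K * x ^ 2) * 2 :=
          mul_le_mul (mul_le_mul_of_nonneg_left e4 g1) j1 (by positivity) (by positivity)
        have := pow_nonneg i1 3
        nlinarith
      have := mul_nonneg hεpos.le (neg_nonneg.2 e5)
      linarith
  refine ⟨ε, hεpos, 3 + A - 2 * K, ?_⟩
  have hK0 : 0 < K := by linarith
  filter_upwards [Ioo_mem_nhdsGT (lt_min hρ (show 0 < 1 / K by positivity))] with x hx
  obtain ⟨h1, h2⟩ := hx
  rw [lt_min_iff, lt_div_iff₀ hK0] at h2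
  have e := hK x h1.le (h2.1.le.trans hρL.le)
  have := key x (H - x) h1.le h2.1.le (by linarith) (by nlinarith)
  have e2 : w x (H - x) = x ^ 2 + (3 + A - 2 * K) * x ^ 3 := by
    simp only [hw]
    ring
  rw [e2] at this
  linarith

theorem vx_crest_pos (hL : 0 < L) (hM : W.MonotoneHalf) :
    0 < pdX W.v (0, W.η 0) := by
  have hb := W.bed_lt_surface hL 0
  have hxx := W.contDiff_vx.differentiable two_ne_zero
  have hyy := W.contDiff_vy.differentiable two_ne_zero
  have hge : 0 ≤ pdX W.v (0, W.η 0) + deriv W.η 0 * pdY W.v (0, W.η 0) :=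
    (W.hasDerivAt_surface W.differentiable_v 0).nonneg_of_eventually_right (by
      filter_upwards [Ioo_mem_nhdsGT hL] with t ht
      rw [W.v_zero]
      exact W.v_nonneg hM ht.1.le ht.2.le (W.bed_lt_surface hL t).le le_rfl)
  rw [W.vy_zero, mul_zero, add_zero] at hge
  refine hge.lt_of_ne fun h0 => ?_
  have huxx : pdX (pdX W.u) (0, W.η 0) = 0 := by
    have := W.sq_u_mul_uxx_add hL (x := 0) (W.v_zero _) (W.ux_zero _)
    rw [← h0, zero_mul, add_zero] at this
    exact (mul_eq_zero.1 this).resolve_left (pow_ne_zero _ (W.u_neg hb.le le_rfl).ne)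
  have hvxy := W.vxy_closed hL hb.le (le_refl (W.η 0))
  rw [huxx, neg_zero] at hvxy
  have hvyx : pdY (pdX W.v) (0, W.η 0) = 0 := by
    rw [← pdX_pdY_comm (W.v_smooth.of_le (by norm_num)), hvxy]
  obtain ⟨ε, hε, c, hbar⟩ := W.exists_crest_barrier hL hM
  have hl : ∀ t, HasDerivAt (fun s => W.η 0 - s) (-1) t := fun t => by
    simpa using (hasDerivAt_id t).const_sub (W.η 0)
  have hp : ∀ t, HasDerivAt (fun s => ε * (s ^ 2 + c * s ^ 3)) (ε * (2 * t + c * (3 * t ^ 2))) t :=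
    fun t => by
      have e := hasDerivAt_id' t
      refine (((e.fun_pow 2).fun_add ((e.fun_pow 3).const_mul c)).const_mul ε).congr_deriv ?_
      push_cast
      ring
  have hp' : HasDerivAt (fun t => ε * (2 * t + c * (3 * t ^ 2))) (ε * 2) 0 := by
    have e := hasDerivAt_id' (0 : ℝ)
    refine (((e.const_mul 2).fun_add (((e.fun_pow 2).const_mul 3).const_mul c)).const_mul
      ε).congr_deriv ?_
    push_cast
    ring
  have := nonneg_second_deriv_of_eventually_right
    (fun t => (hasDerivAt_graph W.differentiable_v (hl t)).fun_sub (hp t))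
    (((hasDerivAt_graph hxx (hl 0)).fun_add
      ((hasDerivAt_graph hyy (hl 0)).const_mul (-1))).fun_sub hp')
    (by simp [← h0, W.vy_zero])
    (by
      filter_upwards [hbar] with t ht
      simp only [W.v_zero]
      linarith)
  simp only [sub_zero] at this
  rw [W.vxx_zero, W.vyy_zero, hvxy, hvyx] at this
  linarith

end Endpoint

section Positivity

variable {W}

theorem G_pos_Ioo (hL : 0 < L) (hg : 0 < g) (hM : W.MonotoneHalf)
    (hγ : ∀ s ∈ Icc (0:ℝ) W.m, W.γ s ≤ 0)
    (hdγ : ∀ s ∈ Icc (0:ℝ) W.m, W.dγ s ≤ 0) (hddγ : ∀ s ∈ Icc (0:ℝ) W.m, W.ddγ s ≤ 0)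
    (hux : ∀ x, 0 ≤ x → x ≤ L → pdX W.u (x, W.η x) ≤ 0)
    (hG : ∀ x, 0 < x → x < L → 0 ≤ W.G x) {x : ℝ} (h1 : 0 < x) (h2 : x < L) : 0 < W.G x := by
  refine (hG x h1 h2).lt_of_ne fun h0 => ?_
  have hb := W.bed_lt_surface hL x
  have hu := W.u_neg hb.le le_rfl
  have hv : 0 < W.v (x, W.η x) := hM _ (Or.inr ⟨h1, h2, rfl⟩)
  have hη : deriv W.η x < 0 := by
    rw [W.deriv_η_eq hL]
    exact div_neg_of_pos_of_neg hv hu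
  have hdx := W.contDiff_ux.differentiable two_ne_zero
  have ha : pdX W.u (x, W.η x) = 0 := by
    have := W.surface_identity hL x
    rw [← h0, mul_zero, add_zero] at this
    have hQ := W.sq_v_lt_sq_u_surface hL hM hγ hux h1.le h2.le
    exact (mul_eq_zero.1 this).resolve_left (by linarith)
  have hlm : IsLocalMin W.G x := by
    filter_upwards [Ioo_mem_nhds h1 h2] with t ht
    rw [← h0]
    exact hG t ht.1 ht.2
  have hG' := hlm.hasDerivAt_eq_zero (W.hasDerivAt_G hL x)
  have hamax : IsLocalMax (fun t => pdX W.u (t, W.η t)) x := by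
    filter_upwards [Ioo_mem_nhds h1 h2] with t ht
    rw [ha]
    exact hux t ht.1.le ht.2.le
  have ht := hamax.hasDerivAt_eq_zero (W.hasDerivAt_surface hdx x)
  have hay : 0 ≤ pdY (pdX W.u) (x, W.η x) :=
    (hasDerivAt_sliceY hdx x (W.η x)).nonneg_of_eventually_left (by
      filter_upwards [Ioo_mem_nhdsLT hb] with t ht
      rw [ha]
      exact W.ux_nonpos hL hM hdγ hddγ hux h1.le h2.le ht.1.le ht.2.le)
  have hlap := W.laplacian_u_nonpos hL hdγ hb.le (le_refl (W.η x))
  have hGe := W.G_eq hL x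
  rw [← h0] at hGe
  have hγ0 := hγ 0 ⟨le_rfl, W.m_pos.le⟩
  rw [pdX_pdY_comm (W.u_smooth.of_le (by norm_num)), ha, zero_add] at hG'
  set u := W.u (x, W.η x)
  set e := deriv W.η x
  set b := pdY W.u (x, W.η x)
  have hB : 0 < 2 * b + W.γ 0 := by
    by_contra! hn
    nlinarith
  have hbpos : 0 < b := by linarith
  have i1 : e * b * (2 * b + W.γ 0) < 0 :=
    mul_neg_of_neg_of_pos (mul_neg_of_neg_of_pos hη hbpos) hB
  have i2 : 0 ≤ pdY (pdX W.u) (x, W.η x) + e * pdY (pdY W.u) (x, W.η x) := by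
    nlinarith [mul_nonneg (sq_nonneg e) hay]
  nlinarith [mul_nonneg (neg_nonneg.2 hu.le) i2]

theorem G_nonneg_Ioo (hL : 0 < L) (hM : W.MonotoneHalf)
    (hγ : ∀ s ∈ Icc (0:ℝ) W.m, W.γ s ≤ 0)
    (hux : ∀ x, 0 ≤ x → x ≤ L → pdX W.u (x, W.η x) ≤ 0) {x : ℝ} (h1 : 0 < x) (h2 : x < L) :
    0 ≤ W.G x := by
  have hv : 0 < W.v (x, W.η x) := hM _ (Or.inr ⟨h1, h2, rfl⟩)
  have hQ := W.sq_v_lt_sq_u_surface hL hM hγ hux h1.le h2.le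
  have hS := W.surface_identity hL x
  have ha := hux x h1.le h2.le
  by_contra! hn
  nlinarith [mul_nonneg (sub_nonneg.2 hQ.le) (neg_nonneg.2 ha), mul_neg_of_pos_of_neg hv hn]

theorem G_crest_ne_zero (hL : 0 < L) (hg : 0 < g) (hM : W.MonotoneHalf)
    (hγ : ∀ s ∈ Icc (0:ℝ) W.m, W.γ s ≤ 0)
    (hdγ : ∀ s ∈ Icc (0:ℝ) W.m, W.dγ s ≤ 0) (hddγ : ∀ s ∈ Icc (0:ℝ) W.m, W.ddγ s ≤ 0)
    (hux : ∀ x, 0 ≤ x → x ≤ L → pdX W.u (x, W.η x) ≤ 0) : W.G 0 ≠ 0 := by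
  intro h0
  have hb := W.bed_lt_surface hL 0
  have hu := W.u_neg hb.le le_rfl
  have hc := W.vx_crest_pos hL hM
  have huxx : pdX (pdX W.u) (0, W.η 0) = 0 := by
    have := W.sq_u_mul_uxx_add hL (x := 0) (W.v_zero _) (W.ux_zero _)
    rw [h0, mul_zero, add_zero] at this
    exact (mul_eq_zero.1 this).resolve_left (pow_ne_zero _ hu.ne)
  have hη0 : deriv W.η 0 = 0 := by rw [W.deriv_η_eq hL, W.v_zero, zero_div]
  have hη : HasDerivAt (deriv W.η) (pdX W.v (0, W.η 0) / W.u (0, W.η 0)) 0 := by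
    rw [show deriv W.η = fun x => W.v (x, W.η x) / W.u (x, W.η x) from
      funext (W.deriv_η_eq hL)]
    refine ((W.hasDerivAt_surface W.differentiable_v 0).fun_div
      (W.hasDerivAt_surface W.differentiable_u 0) hu.ne).congr_deriv ?_
    rw [hη0, W.v_zero]
    have := hu.ne
    field_simp
    ring
  have hη'' : pdX W.v (0, W.η 0) / W.u (0, W.η 0) < 0 := div_neg_of_pos_of_neg hc hu
  have hdx := W.contDiff_ux.differentiable two_ne_zero
  have hdy := W.contDiff_uy.differentiable two_ne_zero
  have hdxy := (contDiff_pdX W.contDiff_uy (m := 1) (by norm_num)).differentiable one_ne_zero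
  have hdyy := (contDiff_pdY W.contDiff_uy (m := 1) (by norm_num)).differentiable one_ne_zero
  have hdxx := (contDiff_pdX W.contDiff_ux (m := 1) (by norm_num)).differentiable one_ne_zero
  have huxxy : 0 ≤ pdX (pdX (pdY W.u)) (0, W.η 0) := by
    have h1 : pdX (pdX (pdY W.u)) = pdY (pdX (pdX W.u)) := by
      rw [pdX_pdY_comm (W.u_smooth.of_le (by norm_num)), pdX_pdY_comm W.contDiff_ux]
    rw [h1]
    refine (hasDerivAt_sliceY hdxx 0 (W.η 0)).nonneg_of_eventually_left ?_
    filter_upwards [Ioo_mem_nhdsLT hb] with y hy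
    rw [huxx]
    have := ((hasDerivAt_sliceX hdx 0 y).fun_neg).nonneg_of_eventually_right (by
      have hcη := (W.continuous_η.continuousAt (x := 0)).eventually_const_lt hy.2
      filter_upwards [Ioo_mem_nhdsGT hL, nhdsWithin_le_nhds hcη] with t ht ht'
      rw [W.ux_zero, neg_zero, neg_nonneg]
      exact W.ux_nonpos hL hM hdγ hddγ hux ht.1.le ht.2.le hy.1.le ht'.le)
    linarith
  have hG' := ((((W.hasDerivAt_surface hdx 0).fun_add
    (hη.fun_mul (W.hasDerivAt_surface hdy 0))).fun_mul
    (((W.hasDerivAt_surface hdy 0).const_mul 2).add_const (W.γ 0))).fun_add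
    ((W.hasDerivAt_surface W.differentiable_u 0).fun_mul
      (((W.hasDerivAt_surface hdxy 0).fun_add
        (hη.fun_mul (W.hasDerivAt_surface hdyy 0))).const_mul 2)))
  have huxy : pdX (pdY W.u) (0, W.η 0) = 0 := by
    rw [pdX_pdY_comm (W.u_smooth.of_le (by norm_num)), W.uxy_zero]
  have := nonneg_second_deriv_of_eventually_right (W.hasDerivAt_G hL) hG'
    (by rw [hη0, W.ux_zero, huxy]; ring)
    (by
      rw [h0]
      filter_upwards [Ioo_mem_nhdsGT hL] with t ht
      exact W.G_nonneg_Ioo hL hM hγ hux ht.1 ht.2)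
  rw [hη0, W.ux_zero, huxy, huxx] at this
  have hlap := W.laplacian_u_nonpos hL hdγ hb.le (le_refl (W.η 0))
  have hGe := W.G_eq hL 0
  rw [h0] at hGe
  have hγ0 := hγ 0 ⟨le_rfl, W.m_pos.le⟩
  rw [huxx, zero_add] at hlap
  set u := W.u (0, W.η 0)
  set e := pdX W.v (0, W.η 0) / u
  set b := pdY W.u (0, W.η 0)
  have hB : 0 < 2 * b + W.γ 0 := by
    by_contra! hn
    nlinarith
  have hbpos : 0 < b := by linarith
  have i1 : e * b * (2 * b + W.γ 0) < 0 :=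
    mul_neg_of_neg_of_pos (mul_neg_of_neg_of_pos hη'' hbpos) hB
  have i2 : 0 ≤ pdX (pdX (pdY W.u)) (0, W.η 0) + e * pdY (pdY W.u) (0, W.η 0) := by
    nlinarith
  nlinarith [mul_nonneg (neg_nonneg.2 hu.le) i2]

/-- A wave with `u_x ≤ 0` on the surface and `u_xx ≠ 0` at the trough has `G > 0`. -/
theorem G_pos (hL : 0 < L) (hg : 0 < g) (hM : W.MonotoneHalf)
    (hγ : ∀ s ∈ Icc (0:ℝ) W.m, W.γ s ≤ 0)
    (hdγ : ∀ s ∈ Icc (0:ℝ) W.m, W.dγ s ≤ 0) (hddγ : ∀ s ∈ Icc (0:ℝ) W.m, W.ddγ s ≤ 0)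
    (hux : ∀ x, 0 ≤ x → x ≤ L → pdX W.u (x, W.η x) ≤ 0)
    (htrough : pdX (pdX W.u) (L, W.η L) ≠ 0) {x : ℝ} (h1 : 0 ≤ x) (h2 : x ≤ L) :
    0 < W.G x := by
  have hinner : ∀ x, 0 < x → x < L → 0 ≤ W.G x := fun x i1 i2 =>
    W.G_nonneg_Ioo hL hM hγ hux i1 i2
  have hnn : 0 ≤ W.G x := by
    have : -W.G x ≤ 0 := nonpos_of_nonpos_Ioo (W.continuous_G hL).neg hL
      (fun y i1 i2 => neg_nonpos.2 (hinner y i1 i2)) h1 h2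
    linarith
  refine hnn.lt_of_ne fun h0 => ?_
  rcases h1.eq_or_lt with rfl | h1
  · exact W.G_crest_ne_zero hL hg hM hγ hdγ hddγ hux h0.symm
  rcases h2.eq_or_lt with rfl | h2
  · have hu := W.u_neg (W.bed_lt_surface hL x).le le_rfl
    have := W.sq_u_mul_uxx_add hL (x := x) (W.v_L _) (W.ux_L _)
    rw [← h0, mul_zero, add_zero] at this
    exact htrough ((mul_eq_zero.1 this).resolve_left (pow_ne_zero _ hu.ne))
  · exact (W.G_pos_Ioo hL hg hM hγ hdγ hddγ hux hinner h1 h2).ne h0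

end Positivity

section Continuation

variable {W}

theorem exists_G_ge (hL : 0 < L) (hM : W.MonotoneHalf)
    (hdγ : ∀ s ∈ Icc (0:ℝ) W.m, W.dγ s ≤ 0)
    (hQ : ∀ x, 0 ≤ x → x ≤ L → 0 < W.u (x, W.η x) ^ 2 - W.v (x, W.η x) ^ 2) :
    ∃ x, 0 ≤ x ∧ x ≤ L ∧
      Real.pi / (4 * L) * (W.u (x, W.η x) ^ 2 - W.v (x, W.η x) ^ 2) ≤ W.G x := by
  obtain ⟨x, h1, h2, h3⟩ := W.exists_vy_ge hL hM hdγ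
  refine ⟨x, h1.le, h2.le, ?_⟩
  have hv : 0 < W.v (x, W.η x) := hM _ (Or.inr ⟨h1, h2, rfl⟩)
  have hS := W.surface_identity hL x
  rw [W.incompressible_closed hL (W.bed_lt_surface hL x).le le_rfl] at h3
  have := mul_le_mul_of_nonneg_left h3 (hQ x h1.le h2.le).le
  refine le_of_mul_le_mul_left ?_ hv
  linarith

theorem ux_surface_nonpos_of_G_pos (hL : 0 < L) {x : ℝ} (hv : 0 ≤ W.v (x, W.η x))
    (hQ : 0 < W.u (x, W.η x) ^ 2 - W.v (x, W.η x) ^ 2) (hG : 0 < W.G x) :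
    pdX W.u (x, W.η x) ≤ 0 := by
  have hS := W.surface_identity hL x
  by_contra! hn
  nlinarith [mul_pos hQ hn, mul_nonneg hv hG.le]

theorem IsTrivial.trace_eq (h : W.IsTrivial) (x : ℝ) :
    W.trace x = (W.u (0, 0), 0, 0, 0, pdY W.u (0, 0), 0, 0) := by
  obtain ⟨h1, h2, h3, -⟩ := h
  have hx : ∀ p, pdX W.u p = 0 := fun p =>
    (hasDerivAt_sliceX W.differentiable_u p.1 p.2).unique
      ((hasDerivAt_const p.1 (W.u (0, p.2))).congr_of_eventuallyEq
        (Eventually.of_forall fun t => h3 t 0 p.2))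
  have hx0 : pdX W.u = fun _ => 0 := funext hx
  have hv0 : W.v = fun _ => 0 := funext h1
  have hy : pdY W.u (x, 0) = pdY W.u (0, 0) :=
    (hasDerivAt_sliceY W.differentiable_u x 0).unique
      ((hasDerivAt_sliceY W.differentiable_u 0 0).congr_of_eventuallyEq
        (Eventually.of_forall fun t => h3 x 0 t))
  simp only [trace, h2, hx0, hv0, hy, h3 x 0 0]
  simp [pdX, pdY]

theorem continuous_trace : Continuous W.trace := by
  have hη := W.continuous_η
  have h1 := W.u_smooth.continuous
  have h2 := W.v_smooth.continuous
  have h3 := W.contDiff_ux.continuous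
  have h4 := W.contDiff_vx.continuous
  have h5 := W.contDiff_uy.continuous
  have h6 : Continuous (pdX (pdX W.u)) :=
    (contDiff_pdX W.contDiff_ux (m := 1) (by norm_num)).continuous
  have h7 : Continuous (pdY (pdX W.u)) :=
    (contDiff_pdY W.contDiff_ux (m := 1) (by norm_num)).continuous
  unfold trace
  fun_prop

/-- The bound `|v| < |u|` for a monotone wave with `u_x ≤ 0` on the surface. -/
theorem abs_v_lt_abs_u (hL : 0 < L) (hM : W.MonotoneHalf)
    (hγ : ∀ s ∈ Icc (0:ℝ) W.m, W.γ s ≤ 0) (hdγ : ∀ s ∈ Icc (0:ℝ) W.m, W.dγ s ≤ 0)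
    (hux : ∀ x, 0 ≤ x → x ≤ L → pdX W.u (x, W.η x) ≤ 0) {p : ℝ × ℝ} (hp : p ∈ W.Ωbar) :
    |W.v p| < |W.u p| := by
  have hhalf : ∀ x y, 0 ≤ x → x ≤ L → -W.d ≤ y → y ≤ W.η x → |W.v (x, y)| < |W.u (x, y)| := by
    intro x y h1 h2 h3 h4
    rw [abs_of_nonneg (W.v_nonneg hM h1 h2 h3 h4), abs_of_neg (W.u_neg h3 h4)]
    refine W.v_lt_neg_u hL hdγ (fun t g1 g2 => ?_) h1 h2 h3 h4
    have hb := W.bed_lt_surface hL t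
    exact lt_of_pow_lt_pow_left₀ 2 (neg_nonneg.2 (W.u_neg hb.le le_rfl).le)
      (by rw [neg_sq]; exact W.sq_v_lt_sq_u_surface hL hM hγ hux g1 g2)
  obtain ⟨x, y⟩ := p
  obtain ⟨h1, h2, h3, h4⟩ := hp
  rcases le_total 0 x with h | h
  · exact hhalf x y h h2 h3 h4
  · have := hhalf (-x) y (neg_nonneg.2 h) (neg_le.1 h1) h3 (by rwa [W.η_even])
    rwa [W.v_odd, W.u_even, abs_neg] at this

end Continuation

/-- `G` as a function of the trace. -/
def traceG (g : ℝ) (q : ℝ × ℝ × ℝ × ℝ × ℝ × ℝ × ℝ) : ℝ :=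
  q.1 * (q.2.2.2.2.1 + q.2.2.2.1) + g

/-- `u² - v²` as a function of the trace. -/
def traceQ (q : ℝ × ℝ × ℝ × ℝ × ℝ × ℝ × ℝ) : ℝ := q.1 ^ 2 - q.2.1 ^ 2

theorem continuous_traceG (g : ℝ) : Continuous (traceG g) := by unfold traceG; fun_prop

theorem continuous_traceQ : Continuous traceQ := by unfold traceQ; fun_prop

/-- Along a set of waves with connected trace, `u_x ≤ 0` on the surface persists. -/
theorem ux_surface_nonpos (hg : 0 < g) (hL : 0 < L)
    (M : Set (PeriodicWave g Patm L)) (hMW : ∀ W ∈ M, W.MemW)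
    (hconn : IsConnected {f : C(↥(Set.Icc (0:ℝ) L), ℝ × ℝ × ℝ × ℝ × ℝ × ℝ × ℝ) |
      ∃ W ∈ M, ∀ x : ↥(Set.Icc (0:ℝ) L), f x = W.trace x.1})
    (htriv : ∃ W ∈ M, W.IsTrivial)
    (htrough : ∀ W ∈ M, ¬W.IsTrivial → pdX (pdX W.u) (L, W.η L) ≠ 0) :
    ∀ W ∈ M, ∀ x, 0 ≤ x → x ≤ L → pdX W.u (x, W.η x) ≤ 0 := by
  set κ := Real.pi / (4 * L)
  have hUo : IsOpen {q | 0 < traceG g q ∧ 0 < traceQ q} :=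
    (isOpen_lt continuous_const (continuous_traceG g)).inter
      (isOpen_lt continuous_const continuous_traceQ)
  have hTo : IsOpen {q | traceG g q < κ * traceQ q ∧ 0 < traceQ q} :=
    (isOpen_lt (continuous_traceG g) (continuous_const.mul continuous_traceQ)).inter
      (isOpen_lt continuous_const continuous_traceQ)
  set S := {f : C(↥(Set.Icc (0:ℝ) L), ℝ × ℝ × ℝ × ℝ × ℝ × ℝ × ℝ) |
    ∃ W ∈ M, ∀ x : ↥(Set.Icc (0:ℝ) L), f x = W.trace x.1} with hS
  set O := {f : C(↥(Set.Icc (0:ℝ) L), ℝ × ℝ × ℝ × ℝ × ℝ × ℝ × ℝ) |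
      MapsTo f univ {q | 0 < traceG g q ∧ 0 < traceQ q}} ∪
    {f | MapsTo f univ {q | traceG g q < κ * traceQ q ∧ 0 < traceQ q}} with hO
  set O' := {f : C(↥(Set.Icc (0:ℝ) L), ℝ × ℝ × ℝ × ℝ × ℝ × ℝ × ℝ) |
    ∃ x, 0 < (f x).2.2.1} with hO'
  have hOo : IsOpen O := (ContinuousMap.isOpen_setOfPred_mapsTo isCompact_univ hUo).union
    (ContinuousMap.isOpen_setOfPred_mapsTo isCompact_univ hTo)
  have hO'o : IsOpen O' := by
    have : O' = ⋃ x, {f | 0 < (f x).2.2.1} := by ext f; simp [hO']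
    rw [this]
    refine isOpen_iUnion fun x => isOpen_lt continuous_const ?_
    have := ContinuousEvalConst.continuous_eval_const
      (F := C(↥(Set.Icc (0:ℝ) L), ℝ × ℝ × ℝ × ℝ × ℝ × ℝ × ℝ)) x
    fun_prop
  -- a wave with `u_x ≤ 0` on the surface has its trace in `O`
  have hmem : ∀ W ∈ M, ∀ f : C(↥(Set.Icc (0:ℝ) L), ℝ × ℝ × ℝ × ℝ × ℝ × ℝ × ℝ),
      (∀ x : ↥(Set.Icc (0:ℝ) L), f x = W.trace x.1) →
      (∀ x, 0 ≤ x → x ≤ L → pdX W.u (x, W.η x) ≤ 0) → f ∈ O := by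
    intro W hW f hf hux
    obtain ⟨hγ, hdγ, hddγ, hM⟩ := hMW W hW
    by_cases hT : W.IsTrivial
    · have hu : W.u (0, 0) < 0 := by
        have hη := hT.2.1 0
        exact W.u_neg (by linarith [W.d_pos]) hη.ge
      have hQ : 0 < W.u (0, 0) ^ 2 - 0 ^ 2 := by nlinarith
      have hκ : 0 < κ := by positivity
      rcases le_or_gt (W.u (0, 0) * (pdY W.u (0, 0) + 0) + g) 0 with hG | hG
      · refine Or.inr fun x _ => ?_
        rw [hf, hT.trace_eq]
        exact ⟨hG.trans_lt (mul_pos hκ hQ), hQ⟩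
      · refine Or.inl fun x _ => ?_
        rw [hf, hT.trace_eq]
        exact ⟨hG, hQ⟩
    · have hM := hM.resolve_left hT
      refine Or.inl fun x _ => ?_
      rw [hf]
      exact ⟨W.G_pos hL hg hM hγ hdγ hddγ hux (htrough W hW hT) x.2.1 x.2.2,
        sub_pos.2 (W.sq_v_lt_sq_u_surface hL hM hγ hux x.2.1 x.2.2)⟩
  have htriv_ux : ∀ W : PeriodicWave g Patm L, W.IsTrivial → ∀ x, pdX W.u (x, W.η x) = 0 :=
    fun W hT x => congrArg (fun q => q.2.2.1) (hT.trace_eq x)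
  -- a wave with trace in `O` has `u_x ≤ 0` on the surface
  have hux_of : ∀ W ∈ M, ∀ f : C(↥(Set.Icc (0:ℝ) L), ℝ × ℝ × ℝ × ℝ × ℝ × ℝ × ℝ),
      (∀ x : ↥(Set.Icc (0:ℝ) L), f x = W.trace x.1) → f ∈ O →
      ∀ x, 0 ≤ x → x ≤ L → pdX W.u (x, W.η x) ≤ 0 := by
    intro W hW f hf hfO x h1 h2
    obtain ⟨hγ, hdγ, hddγ, hM⟩ := hMW W hW
    rcases hM with hT | hM
    · exact (htriv_ux W hT x).le
    rcases hfO with hfO | hfO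
    · have h := hfO (mem_univ ⟨x, h1, h2⟩)
      rw [hf] at h
      exact W.ux_surface_nonpos_of_G_pos hL
        (W.v_nonneg hM h1 h2 (W.bed_lt_surface hL x).le le_rfl) h.2 h.1
    · have h : ∀ x, 0 ≤ x → x ≤ L →
          traceG g (W.trace x) < κ * traceQ (W.trace x) ∧ 0 < traceQ (W.trace x) :=
        fun x h1 h2 => by
          have := hfO (mem_univ ⟨x, h1, h2⟩)
          rwa [hf] at this
      obtain ⟨z, i1, i2, i3⟩ := W.exists_G_ge hL hM hdγ fun x h1 h2 => (h x h1 h2).2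
      exact absurd (h z i1 i2).1 (not_lt.2 i3)
  intro W hW x h1 h2
  by_contra! hpos
  obtain ⟨W₀, hW₀, hT₀⟩ := htriv
  let tr : PeriodicWave g Patm L → C(↥(Set.Icc (0:ℝ) L), ℝ × ℝ × ℝ × ℝ × ℝ × ℝ × ℝ) :=
    fun W => ⟨fun x => W.trace x.1, W.continuous_trace.comp continuous_subtype_val⟩
  obtain ⟨f, ⟨V, hV, hf⟩, hfO, y, hy⟩ := hconn.isPreconnected O O' hOo hO'o
    (fun f ⟨V, hV, hf⟩ => by
      by_cases hux : ∀ x, 0 ≤ x → x ≤ L → pdX V.u (x, V.η x) ≤ 0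
      · exact Or.inl (hmem V hV f hf hux)
      · push Not at hux
        obtain ⟨y, i1, i2, i3⟩ := hux
        refine Or.inr ⟨⟨y, i1, i2⟩, ?_⟩
        rw [hf]
        exact i3)
    ⟨tr W₀, ⟨W₀, hW₀, fun _ => rfl⟩,
      hmem W₀ hW₀ _ (fun _ => rfl) fun x _ _ => (htriv_ux W₀ hT₀ x).le⟩
    ⟨tr W, ⟨W, hW, fun _ => rfl⟩, ⟨x, h1, h2⟩, hpos⟩
  rw [hf] at hy
  exact absurd (hux_of V hV f hf hfO y.1 y.2.1 y.2.2) (not_le.2 hy)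

end PeriodicWave

/-- **Theorem (bound on the slope, alternative trough condition).**  Let `𝓜 ⊆ 𝒲` be a
set of periodic waves whose trace image `τ(𝓜)` is a connected subset of `C([0,L], ℝ⁷)`.
If `𝓜` contains a trivial wave and every nontrivial wave of `𝓜` satisfies `u_xx ≠ 0`
at the trough `(L, η L)`, then every streamline of every wave of `𝓜` has slope
`|v/u| < 1`. -/
theorem periodic_slope_lt_one_of_uxx_ne_zero (g Patm L : ℝ) (hg : 0 < g) (hL : 0 < L)
    (M : Set (PeriodicWave g Patm L))
    (hMW : ∀ W ∈ M, W.MemW)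
    (hconn : IsConnected {f : C(↥(Set.Icc (0:ℝ) L), ℝ × ℝ × ℝ × ℝ × ℝ × ℝ × ℝ) |
      ∃ W ∈ M, ∀ x : ↥(Set.Icc (0:ℝ) L), f x = W.trace x.1})
    (htriv : ∃ W ∈ M, W.IsTrivial)
    (htrough : ∀ W ∈ M, ¬W.IsTrivial → pdX (pdX W.u) (L, W.η L) ≠ 0) :
    ∀ W ∈ M, ∀ p ∈ W.Ωbar, |W.v p| < |W.u p| := by
  intro W hW p hp
  obtain ⟨hγ, hdγ, -, hT | hM⟩ := hMW W hW
  · rw [hT.1 p, abs_zero]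
    exact abs_pos.2 (W.u_neg hp.2.2.1 hp.2.2.2).ne
  · exact W.abs_v_lt_abs_u hL hM hγ hdγ
      (PeriodicWave.ux_surface_nonpos hg hL M hMW hconn htriv htrough W hW) hp
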